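/- arXiv:1506.09168 — 5 statements merged into one kernel-verified Lean document; each statement's English description precedes it below -/
import Mathlib

section
/- Let (R,m,k) be a one-dimensional Cohen–Macaulay local ring and x ∈ m a non zero-divisor of order d. Then λ(R/(x)) = d·e(R) if and only if x is a superficial element, i.e., there exists an integer c such that (m^{n+d} : x) ∩ m^c = m^n for all n ≥ c. -/
open IsLocalRing

universe u v

/-- The length of a module, as the Krull dimension of its lattice of submodules. -/
noncomputable def mLength (R : Type u) (M : Type v) [CommRing R] [AddCommGroup M]
    [Module R M] : WithBot ℕ∞ :=
  Order.krullDim (Submodule R M)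

/-- The quotient `I/J` of two ideals (i.e. `I/(I ⊓ J)`), as an `R`-module. -/
abbrev idealQuot {R : Type u} [CommRing R] (I J : Ideal R) :=
  I ⧸ (Submodule.comap I.subtype J)

/-- A finitely generated module is maximal Cohen–Macaulay if it admits a regular sequence,
contained in the maximal ideal, of length equal to the Krull dimension of the ring. -/
def IsMCM (R : Type u) (M : Type v) [CommRing R] [IsLocalRing R] [AddCommGroup M]
    [Module R M] : Prop :=
  ∃ rs : List R, (∀ r ∈ rs, r ∈ maximalIdeal R) ∧ RingTheory.Sequence.IsRegular M rs ∧
    (rs.length : WithBot ℕ∞) = ringKrullDim R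

/-- A local ring is Cohen–Macaulay if it is maximal Cohen–Macaulay as a module over itself. -/
def IsCMLocalRing (R : Type u) [CommRing R] [IsLocalRing R] : Prop :=
  IsMCM R R

/-- A local ring is Gorenstein if it is Cohen–Macaulay and the socle of the quotient by any
maximal regular sequence is a one-dimensional vector space over the residue field. -/
def IsGorensteinLocalRing (R : Type u) [CommRing R] [IsLocalRing R] : Prop :=
  IsCMLocalRing R ∧ ∀ rs : List R, (∀ r ∈ rs, r ∈ maximalIdeal R) →
    RingTheory.Sequence.IsRegular R rs → (rs.length : WithBot ℕ∞) = ringKrullDim R →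
    mLength R (idealQuot ((Ideal.ofList rs).colon (maximalIdeal R)) (Ideal.ofList rs)) = 1

/-- The free rank of a module: the largest `n` such that `R^n` splits off as a direct summand. -/
noncomputable def freeRank (R : Type u) (M : Type v) [CommRing R] [AddCommGroup M]
    [Module R M] : ℕ :=
  sSup {n : ℕ | ∃ (f : M →ₗ[R] (Fin n → R)) (g : (Fin n → R) →ₗ[R] M),
    f ∘ₗ g = LinearMap.id}

/-- Auslander's delta invariant: the minimal free rank of a maximal Cohen–Macaulay module
admitting a surjection onto `M`. -/
noncomputable def auslanderDelta (R : Type u) [CommRing R] [IsLocalRing R]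
    (M : Type v) [AddCommGroup M] [Module R M] : ℕ :=
  sInf {r : ℕ | ∃ X : ModuleCat.{u} R, Module.Finite R X ∧ IsMCM R X ∧
    (∃ φ : X →ₗ[R] M, Function.Surjective φ) ∧ freeRank R X = r}

/-- The minimal number of generators of a module. -/
noncomputable def minGens (R : Type u) (M : Type v) [CommRing R] [AddCommGroup M]
    [Module R M] : ℕ :=
  sInf {n : ℕ | ∃ f : (Fin n → R) →ₗ[R] M, Function.Surjective f}

/-- The index of a local ring: the least `n` with `δ(R/m^n) = 1`. -/
noncomputable def ringIndex (R : Type u) [CommRing R] [IsLocalRing R] : ℕ∞ :=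
  sInf ((fun n : ℕ => (n : ℕ∞)) ''
    {n : ℕ | auslanderDelta R (R ⧸ (maximalIdeal R ^ n)) = 1})

/-- The generalized Löwy length of a local ring: the least `n` such that `m^n ⊆ (x₁,…,x_d)`
for some system of parameters `x₁,…,x_d`. -/
noncomputable def gll (R : Type u) [CommRing R] [IsLocalRing R] : ℕ∞ :=
  sInf ((fun n : ℕ => (n : ℕ∞)) ''
    {n : ℕ | ∃ rs : List R, (∀ r ∈ rs, r ∈ maximalIdeal R) ∧
      (rs.length : WithBot ℕ∞) = ringKrullDim R ∧
      maximalIdeal R ^ n ≤ Ideal.ofList rs})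

/-- Additivity of length for a pair of ideals `A ≤ B`. -/
theorem aux_length_pair {R : Type u} [CommRing R] {A B : Ideal R} (h : A ≤ B) :
    Module.length R (R ⧸ A) = Module.length R (idealQuot B A) + Module.length R (R ⧸ B) := by
  refine Module.length_eq_add_of_exact
    (Submodule.mapQ (Submodule.comap B.subtype A) A B.subtype le_rfl)
    (Submodule.mapQ A B LinearMap.id h) ?_ ?_ ?_
  · rw [← LinearMap.ker_eq_bot, Submodule.ker_mapQ]
    simp
  · intro y
    obtain ⟨y, rfl⟩ := Submodule.Quotient.mk_surjective _ y
    exact ⟨Submodule.Quotient.mk y, rfl⟩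
  · intro y
    obtain ⟨y, rfl⟩ := Submodule.Quotient.mk_surjective _ y
    constructor
    · intro hy
      have hy' : y ∈ B := (Submodule.Quotient.mk_eq_zero B).1 hy
      exact ⟨Submodule.Quotient.mk ⟨y, hy'⟩, rfl⟩
    · rintro ⟨z, hz⟩
      obtain ⟨z, rfl⟩ := Submodule.Quotient.mk_surjective _ z
      rw [← hz]
      exact (Submodule.Quotient.mk_eq_zero B).2 z.2

/-- Additivity of length along multiplication by a non zero-divisor. -/
theorem aux_length_mul {R : Type u} [CommRing R] {x : R} (hx : x ∈ nonZeroDivisors R)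
    (I : Ideal R) :
    Module.length R (R ⧸ (Ideal.span {x} * I)) =
      Module.length R (R ⧸ I) + Module.length R (R ⧸ Ideal.span {x}) := by
  refine Module.length_eq_add_of_exact
    (Submodule.mapQ I (Ideal.span {x} * I) (LinearMap.mulLeft R x) ?_)
    (Submodule.mapQ (Ideal.span {x} * I) (Ideal.span {x}) LinearMap.id Ideal.mul_le_left) ?_ ?_ ?_
  · intro y hy
    exact Ideal.mul_mem_mul (Ideal.mem_span_singleton_self x) hy
  · rw [injective_iff_map_eq_zero]
    intro y hy
    obtain ⟨y, rfl⟩ := Submodule.Quotient.mk_surjective _ y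
    have hy' : x * y ∈ Ideal.span {x} * I := (Submodule.Quotient.mk_eq_zero _).1 hy
    obtain ⟨z, hz, hzy⟩ := Ideal.mem_span_singleton_mul.1 hy'
    rw [mul_cancel_left_mem_nonZeroDivisors hx] at hzy
    exact (Submodule.Quotient.mk_eq_zero _).2 (hzy ▸ hz)
  · intro y
    obtain ⟨y, rfl⟩ := Submodule.Quotient.mk_surjective _ y
    exact ⟨Submodule.Quotient.mk y, rfl⟩
  · intro y
    obtain ⟨y, rfl⟩ := Submodule.Quotient.mk_surjective _ y
    constructor
    · intro hy
      have hy' : y ∈ Ideal.span {x} := (Submodule.Quotient.mk_eq_zero (Ideal.span {x})).1 hy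
      obtain ⟨z, rfl⟩ := Ideal.mem_span_singleton.1 hy'
      exact ⟨Submodule.Quotient.mk z, rfl⟩
    · rintro ⟨z, hz⟩
      obtain ⟨z, rfl⟩ := Submodule.Quotient.mk_surjective _ z
      rw [← hz]
      exact (Submodule.Quotient.mk_eq_zero (Ideal.span {x})).2
        (Ideal.mem_span_singleton.2 (Dvd.intro z rfl))

theorem aux_length_zero {R : Type u} [CommRing R] {A B : Ideal R} (h : A ≤ B) :
    Module.length R (idealQuot B A) = 0 ↔ A = B := by
  rw [Module.length_eq_zero_iff, Submodule.Quotient.subsingleton_iff,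
    Submodule.comap_subtype_eq_top]
  exact ⟨fun h' => le_antisymm h h', fun h' => h'.ge⟩

theorem aux_mLength {R : Type u} {M : Type v} [CommRing R] [AddCommGroup M] [Module R M]
    (a : ℕ) : mLength R M = ((a : ℕ∞) : WithBot ℕ∞) ↔ Module.length R M = a := by
  rw [mLength, ← Module.coe_length, WithBot.coe_inj]

theorem aux_main {R : Type u} [CommRing R] [IsLocalRing R]
    (hfin : ∀ n, Module.length R (R ⧸ (maximalIdeal R ^ n)) ≠ ⊤)
    {x : R} (hx : x ∈ nonZeroDivisors R)
    {d : ℕ} (hxd : x ∈ maximalIdeal R ^ d) {e N : ℕ}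
    (he : ∀ n ≥ N, Module.length R (idealQuot (maximalIdeal R ^ n)
        (maximalIdeal R ^ (n + 1))) = e) (n : ℕ) (hn : N ≤ n) :
    Module.length R (R ⧸ Ideal.span {x}) = (d * e : ℕ) ↔
      Ideal.span {x} * maximalIdeal R ^ n = maximalIdeal R ^ (n + d) := by
  have hle : Ideal.span {x} * maximalIdeal R ^ n ≤ maximalIdeal R ^ (n + d) := by
    rw [add_comm, pow_add]
    exact Ideal.mul_mono_left ((Ideal.span_singleton_le_iff_mem _).2 hxd)
  have hsum : ∀ k : ℕ, Module.length R (R ⧸ (maximalIdeal R ^ (n + k))) =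
      (k * e : ℕ) + Module.length R (R ⧸ (maximalIdeal R ^ n)) := by
    intro k
    induction k with
    | zero => simp
    | succ k ih =>
      rw [← add_assoc, aux_length_pair (Ideal.pow_le_pow_right (Nat.le_succ (n + k))), ih,
        he _ (by omega)]
      push_cast
      ring
  rw [← aux_length_zero hle]
  have h1 := aux_length_mul hx (maximalIdeal R ^ n)
  rw [aux_length_pair hle, hsum d] at h1
  generalize Module.length R (idealQuot (maximalIdeal R ^ (n + d)) (Ideal.span {x} * maximalIdeal R ^ n)) = a at *
  generalize Module.length R (R ⧸ Ideal.span {x}) = b at *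
  have h2 := hfin n
  generalize Module.length R (R ⧸ (maximalIdeal R ^ n)) = t at *
  have h3 : a + (d * e : ℕ) = b := by
    rw [← add_assoc, add_comm t b] at h1
    exact (ENat.add_left_injective_of_ne_top h2) h1
  rw [← h3]
  constructor
  · intro h
    refine (ENat.add_left_injective_of_ne_top (ENat.coe_ne_top (d * e))) ?_
    simpa using h
  · rintro rfl
    simp

/-- For a one-dimensional Cohen–Macaulay local ring `(R,m)` and a
non zero-divisor `x ∈ m` of order `d`, `λ(R/(x)) = d·e(R)` holds if and only if `x` is
a superficial element, i.e. there is `c` with `(m^{n+d} : x) ∩ m^c = m^n` for all `n ≥ c`. -/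
theorem length_quotient_eq_ord_mul_multiplicity_iff_superficial
    (R : Type u) [CommRing R] [IsLocalRing R] [IsNoetherianRing R]
    (hdim : ringKrullDim R = 1) (hCM : IsCMLocalRing R)
    (x : R) (hxm : x ∈ IsLocalRing.maximalIdeal R) (hx : x ∈ nonZeroDivisors R)
    (d : ℕ) (hxd : x ∈ IsLocalRing.maximalIdeal R ^ d)
    (hxd' : x ∉ IsLocalRing.maximalIdeal R ^ (d + 1))
    (e : ℕ)
    (he : ∃ N : ℕ, ∀ n ≥ N,
      mLength R (idealQuot (IsLocalRing.maximalIdeal R ^ n)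
        (IsLocalRing.maximalIdeal R ^ (n + 1))) = ((e : ℕ∞) : WithBot ℕ∞)) :
    mLength R (R ⧸ Ideal.span {x}) = (((d * e : ℕ) : ℕ∞) : WithBot ℕ∞) ↔
      ∃ c : ℕ, ∀ n ≥ c,
        ((IsLocalRing.maximalIdeal R ^ (n + d)).colon (Ideal.span {x})) ⊓
            IsLocalRing.maximalIdeal R ^ c = IsLocalRing.maximalIdeal R ^ n := by
  obtain ⟨N, he⟩ := he
  simp only [aux_mLength] at he ⊢
  have : Ring.KrullDimLE 1 R := by
    rw [Ring.KrullDimLE, Order.krullDimLE_iff]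
    exact hdim.le
  have hfin : ∀ n, Module.length R (R ⧸ (maximalIdeal R ^ n)) ≠ ⊤ := by
    intro n
    have h := isFiniteLength_quotient_span_singleton R (pow_mem hx n)
    rw [← Module.length_ne_top_iff] at h
    have hle : Ideal.span {x ^ n} ≤ maximalIdeal R ^ n :=
      (Ideal.span_singleton_le_iff_mem _).2 (Ideal.pow_mem_pow hxm n)
    rw [aux_length_pair hle] at h
    exact fun h' => h (by rw [h', add_top])
  have key := aux_main hfin hx hxd he
  constructor
  · intro h
    refine ⟨N, fun n hn => le_antisymm ?_ (le_inf ?_ (Ideal.pow_le_pow_right hn))⟩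
    · rintro y ⟨hy, -⟩
      have hy' := Ideal.mem_colon_span_singleton.1 hy
      rw [← (key n hn).1 h] at hy'
      obtain ⟨z, hz, hzy⟩ := Ideal.mem_span_singleton_mul.1 hy'
      rw [mul_comm y x, mul_cancel_left_mem_nonZeroDivisors hx] at hzy
      exact hzy ▸ hz
    · intro y hy
      refine Ideal.mem_colon_span_singleton.2 ?_
      rw [pow_add]
      exact Ideal.mul_mem_mul hy hxd
  · rintro ⟨c, hc⟩
    have hart : IsArtinianRing (R ⧸ Ideal.span {x}) := by
      have h := (isFiniteLength_iff_isNoetherian_isArtinian.1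
        (isFiniteLength_quotient_span_singleton R hx)).2
      exact isArtinian_of_tower R h
    obtain ⟨r, hr⟩ := exists_maximalIdeal_pow_le_of_isArtinianRing_quotient (Ideal.span {x})
    have hn : N ≤ N + r + c := by omega
    refine (key _ hn).2 (le_antisymm ?_ ?_)
    · rw [add_comm _ d, pow_add _ d]
      exact Ideal.mul_mono_left ((Ideal.span_singleton_le_iff_mem _).2 hxd)
    · intro z hz
      have h1 : z ∈ Ideal.span {x} * maximalIdeal R ^ c := by
        have h2 : maximalIdeal R ^ (N + r + c + d) ≤ maximalIdeal R ^ (r + c) :=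
          Ideal.pow_le_pow_right (by omega)
        have h3 := h2 hz
        rw [pow_add] at h3
        exact Ideal.mul_mono_left hr h3
      obtain ⟨y, hy, rfl⟩ := Ideal.mem_span_singleton_mul.1 h1
      refine Ideal.mul_mem_mul (Ideal.mem_span_singleton_self x) ?_
      rw [← hc _ (by omega : N + r + c ≥ c)]
      exact ⟨Ideal.mem_colon_span_singleton.2 (by rwa [mul_comm]), hy⟩
end

section
/- Let (R,m) be a Gorenstein local ring of dimension d and x_1,...,x_d a maximal regular sequence in R. Then δ(R/(x_1,...,x_d)) = 1. Consequently, if m^n ⊆ (x_1,...,x_d) for some n, then δ(R/m^n) = 1, and hence index(R) ≤ gℓℓ(R). -/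
open IsLocalRing

universe u v

open RingTheory.Sequence Pointwise in
lemma length_le_supportDim_of_injective {R : Type u} [CommRing R] [IsLocalRing R]
    [IsNoetherianRing R] (ys : List R) :
    ∀ (M : Type v) [AddCommGroup M] [Module R M] [Module.Finite R M]
      (N : Type v) [AddCommGroup N] [Module R N] [Module.Finite R N] [Nontrivial N]
      (f : N →ₗ[R] M), Function.Injective f → (∀ r ∈ ys, r ∈ maximalIdeal R) →
      IsWeaklyRegular M ys → (ys.length : WithBot ℕ∞) ≤ Module.supportDim R N := by
  induction ys with
  | nil =>
    intro M _ _ _ N _ _ _ _ f hf _ _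
    have := Module.supportDim_ne_bot_of_nontrivial R N
    obtain ⟨a, ha⟩ := WithBot.ne_bot_iff_exists.mp this
    rw [← ha]
    simp only [List.length_nil]
    exact_mod_cast (zero_le (a := a))
  | cons y ys ih =>
    intro M _ _ _ N _ _ _ _ f hf hm hreg
    rw [isWeaklyRegular_cons_iff] at hreg
    obtain ⟨hy, hreg⟩ := hreg
    have hym : y ∈ maximalIdeal R := hm y (by simp)
    let g : ℕ →o Submodule R M :=
      ⟨fun k => (LinearMap.range f).comap (LinearMap.lsmul R M (y ^ k)), by
        apply monotone_nat_of_le_succ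
        intro k m hm
        simp only [Submodule.mem_comap, LinearMap.lsmul_apply] at hm ⊢
        rw [pow_succ', mul_smul]
        exact Submodule.smul_mem _ _ hm⟩
    obtain ⟨k, hk⟩ := monotone_stabilizes_iff_noetherian.mpr (inferInstance : IsNoetherian R M) g
    have hgk : ∀ m, m ∈ g k ↔ y ^ k • m ∈ LinearMap.range f := fun m => Iff.rfl
    have hgk1 : ∀ m, m ∈ g (k+1) ↔ y ^ (k+1) • m ∈ LinearMap.range f := fun m => Iff.rfl
    have h0 : LinearMap.range f ≤ g k := by
      intro m hm
      rw [hgk]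
      exact Submodule.smul_mem _ _ hm
    have hnt : Nontrivial (g k) := by
      obtain ⟨n, hn⟩ := exists_ne (0 : N)
      refine ⟨⟨⟨f n, h0 ⟨n, rfl⟩⟩, 0, ?_⟩⟩
      intro h
      apply hn
      apply hf
      simpa using congrArg Subtype.val h
    -- the multiplication map into the range
    let e : g k →ₗ[R] LinearMap.range f :=
      LinearMap.codRestrict _ ((LinearMap.lsmul R M (y ^ k)) ∘ₗ (g k).subtype)
        (fun c => (hgk c).mp c.2)
    have he : Function.Injective e := by
      intro a b hab
      apply Subtype.ext
      apply hy.pow k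
      exact congrArg Subtype.val hab
    have h1 : Module.supportDim R (g k) ≤ Module.supportDim R N := by
      rw [Module.supportDim_eq_of_equiv (LinearEquiv.ofInjective f hf)]
      exact Module.supportDim_le_of_injective e he
    refine le_trans ?_ h1
    have hyk : IsSMulRegular (g k) y := hy.submodule _ _
    rw [← Module.supportDim_quotSMulTop_succ_eq_supportDim hyk hym]
    have : Nontrivial (QuotSMulTop y (g k)) := nontrivial_quotSMulTop_of_mem_maximalIdeal _ hym
    have := ih (QuotSMulTop y M) (QuotSMulTop y (g k)) (QuotSMulTop.map y (g k).subtype) ?_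
      (fun r hr => hm r (by simp [hr])) hreg
    · push_cast [List.length_cons]
      gcongr
    · rw [← LinearMap.ker_eq_bot, LinearMap.ker_eq_bot']
      intro q hq
      obtain ⟨n, rfl⟩ := Submodule.Quotient.mk_surjective _ q
      have hq' : ((n : M) : M) ∈ y • (⊤ : Submodule R M) := by
        rw [← Submodule.Quotient.mk_eq_zero]
        exact hq
      rw [Submodule.mem_smul_pointwise_iff_exists] at hq'
      obtain ⟨b, -, hb⟩ := hq'
      have hbk : b ∈ g k := by
        rw [hk (k+1) (by omega), hgk1, pow_succ, mul_smul, hb]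
        exact (hgk _).mp n.2
      rw [Submodule.Quotient.mk_eq_zero, Submodule.mem_smul_pointwise_iff_exists]
      exact ⟨⟨b, hbk⟩, trivial, Subtype.ext hb⟩

lemma mem_annihilator_quotSMulTop {R : Type u} [CommRing R] (M : Type v) [AddCommGroup M]
    [Module R M] (x : R) : Ideal.span {x} ⊔ Module.annihilator R M ≤
      Module.annihilator R (QuotSMulTop x M) := by
  refine sup_le ?_ ?_
  · rw [Ideal.span_singleton_le_iff_mem, Module.mem_annihilator]
    intro q
    obtain ⟨n, rfl⟩ := Submodule.Quotient.mk_surjective _ q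
    rw [← Submodule.Quotient.mk_smul, Submodule.Quotient.mk_eq_zero]
    exact Submodule.smul_mem_pointwise_smul _ _ _ trivial
  · intro r hr
    rw [Module.mem_annihilator] at hr ⊢
    intro q
    obtain ⟨n, rfl⟩ := Submodule.Quotient.mk_surjective _ q
    rw [← Submodule.Quotient.mk_smul, hr, Submodule.Quotient.mk_zero]

lemma supportDim_le_length {R : Type u} [CommRing R] [IsLocalRing R]
    [IsNoetherianRing R] (rs : List R) :
    ∀ (N : Type v) [AddCommGroup N] [Module R N] [Module.Finite R N],
      (∀ r ∈ rs, r ∈ maximalIdeal R) →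
      maximalIdeal R ≤ (Ideal.ofList rs ⊔ Module.annihilator R N).radical →
      Module.supportDim R N ≤ (rs.length : WithBot ℕ∞) := by
  induction rs with
  | nil =>
    intro N _ _ _ _ h
    simp only [Ideal.ofList_nil, bot_sup_eq] at h
    have : Subsingleton (Module.support R N) := by
      refine ⟨fun p q => ?_⟩
      have key : ∀ p : Module.support R N, p.1.asIdeal = maximalIdeal R := by
        intro p
        have := p.2
        rw [Module.mem_support_iff_of_finite] at this
        apply le_antisymm (IsLocalRing.le_maximalIdeal p.1.2.ne_top)
        refine h.trans (p.1.2.radical_le_iff.mpr this)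
      apply Subtype.ext
      apply PrimeSpectrum.ext
      rw [key, key]
    simpa [Module.supportDim] using
      (Order.krullDim_nonpos_of_subsingleton (α := Module.support R N))
  | cons x rs ih =>
    intro N _ _ _ hm h
    have := ih (QuotSMulTop x N) (fun r hr => hm r (by simp [hr])) (h.trans (Ideal.radical_mono ?_))
    · refine (Module.supportDim_le_supportDim_quotSMulTop_succ (hm x (by simp))).trans ?_
      push_cast [List.length_cons]
      gcongr
    · rw [Ideal.ofList_cons]
      have := mem_annihilator_quotSMulTop N x
      refine sup_le (sup_le ?_ le_sup_left) ?_
      · exact le_trans (le_sup_left.trans this) le_sup_right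
      · exact le_trans (le_sup_right.trans this) le_sup_right

open CategoryTheory Abelian Limits RingTheory.Sequence Pointwise in
lemma exists_regular_quotSMulTop {R : Type u} [CommRing R] [IsLocalRing R]
    [IsNoetherianRing R] (M : Type u) [AddCommGroup M] [Module R M] [Module.Finite R M]
    [Nontrivial M] (x : R) (hxm : x ∈ maximalIdeal R) (hx : IsSMulRegular M x) (n : ℕ)
    (h : ∃ rs : List R, rs.length = n + 1 ∧ (∀ r ∈ rs, r ∈ maximalIdeal R) ∧ IsRegular M rs) :
    ∃ rs : List R, rs.length = n ∧ (∀ r ∈ rs, r ∈ maximalIdeal R) ∧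
      IsRegular (QuotSMulTop x M) rs := by
  have hlt : ∀ (L : Type u) [AddCommGroup L] [Module R L] [Module.Finite R L] [Nontrivial L],
      maximalIdeal R • (⊤ : Submodule R L) < ⊤ := by
    intro L _ _ _ _
    refine lt_top_iff_ne_top.mpr ?_
    exact (Submodule.top_ne_ideal_smul_of_le_jacobson_annihilator
      (IsLocalRing.maximalIdeal_le_jacobson _)).symm
  have : Nontrivial (QuotSMulTop x M) := nontrivial_quotSMulTop_of_mem_maximalIdeal _ hxm
  have h1 := (ModuleCat.exists_isRegular_tfae (maximalIdeal R) (n+1) (ModuleCat.of R M)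
    (hlt M)).out 3 1 |>.mp h
  refine ((ModuleCat.exists_isRegular_tfae (maximalIdeal R) n
    (ModuleCat.of R (QuotSMulTop x M)) (hlt _)).out 3 1).mpr ?_
  intro i hi
  have zero1 := AddCommGrpCat.isZero_of_iff_subsingleton.mpr (h1 i (by omega))
  have zero2 := AddCommGrpCat.isZero_of_iff_subsingleton.mpr (h1 (i + 1) (by omega))
  exact AddCommGrpCat.subsingleton_of_isZero <| ShortComplex.Exact.isZero_of_both_zeros
    ((Ext.covariant_sequence_exact₃' _
      (IsSMulRegular.smulShortComplex_shortExact (M := ModuleCat.of R M) hx)) i (i + 1) rfl)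
    (zero1.eq_zero_of_src _) (zero2.eq_zero_of_tgt _)

open RingTheory.Sequence Pointwise in
theorem isWeaklyRegular_of_sop {R : Type u} [CommRing R] [IsLocalRing R]
    [IsNoetherianRing R] (rs : List R) :
    ∀ (M : Type u) [AddCommGroup M] [Module R M] [Module.Finite R M] [Nontrivial M],
      (∀ r ∈ rs, r ∈ maximalIdeal R) →
      maximalIdeal R ≤ (Ideal.ofList rs ⊔ Module.annihilator R M).radical →
      (∃ ys : List R, ys.length = rs.length ∧ (∀ r ∈ ys, r ∈ maximalIdeal R) ∧ IsRegular M ys) →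
      IsWeaklyRegular M rs := by
  induction rs with
  | nil => intros; simp
  | cons x rs ih =>
    intro M _ _ _ _ hm h hys
    have hxm : x ∈ maximalIdeal R := hm x (by simp)
    have hx : IsSMulRegular M x := by
      rw [isSMulRegular_iff_ker_lsmul_eq_bot]
      by_contra hne
      have : Nontrivial (LinearMap.ker (LinearMap.lsmul R M x)) :=
        Submodule.nontrivial_iff_ne_bot.mpr hne
      obtain ⟨ys, hl, hym, hyr⟩ := hys
      have h1 := length_le_supportDim_of_injective ys M (LinearMap.ker (LinearMap.lsmul R M x))
        (Submodule.subtype _) (Submodule.subtype_injective _) hym hyr.toIsWeaklyRegular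
      have h2 := supportDim_le_length rs (LinearMap.ker (LinearMap.lsmul R M x))
        (fun r hr => hm r (by simp [hr])) (h.trans (Ideal.radical_mono ?_))
      · have h3 := h1.trans h2
        rw [hl] at h3
        have : (x :: rs).length ≤ rs.length := by exact_mod_cast h3
        simp at this
      · rw [Ideal.ofList_cons]
        refine sup_le (sup_le ?_ le_sup_left) ?_
        · refine le_trans ?_ le_sup_right
          rw [Ideal.span_singleton_le_iff_mem, Module.mem_annihilator]
          intro n
          exact Subtype.ext n.2
        · refine le_trans ?_ le_sup_right
          intro r hr
          rw [Module.mem_annihilator] at hr ⊢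
          intro n
          exact Subtype.ext (hr n)
    rw [isWeaklyRegular_cons_iff]
    refine ⟨hx, ?_⟩
    have : Nontrivial (QuotSMulTop x M) := nontrivial_quotSMulTop_of_mem_maximalIdeal _ hxm
    refine ih (QuotSMulTop x M) (fun r hr => hm r (by simp [hr])) (h.trans (Ideal.radical_mono ?_))
      (exists_regular_quotSMulTop M x hxm hx _ hys)
    rw [Ideal.ofList_cons]
    have := mem_annihilator_quotSMulTop M x
    refine sup_le (sup_le ?_ le_sup_left) ?_
    · exact le_trans (le_sup_left.trans this) le_sup_right
    · exact le_trans (le_sup_right.trans this) le_sup_right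

open RingTheory.Sequence Pointwise in
/-- Monomial property of systems of parameters which are regular on `X`. -/
lemma mem_of_prod_pow_smul_mem {R : Type u} [CommRing R] [IsLocalRing R]
    (X : Type v) [AddCommGroup X] [Module R X] (d : ℕ)
    (H : ∀ zs : List R, zs.length = d → (∀ r ∈ zs, r ∈ maximalIdeal R) →
      maximalIdeal R ≤ (Ideal.ofList zs).radical → IsWeaklyRegular X zs) (k : ℕ) (bs : List R) :
    ∀ (as : List R) (z : X), (as ++ bs).length = d → (∀ r ∈ as ++ bs, r ∈ maximalIdeal R) →
      maximalIdeal R ≤ (Ideal.ofList (as ++ bs)).radical →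
      bs.prod ^ k • z ∈ Ideal.ofList (as ++ bs.map (· ^ (k + 1))) • (⊤ : Submodule R X) →
      z ∈ Ideal.ofList (as ++ bs) • (⊤ : Submodule R X) := by
  induction bs with
  | nil =>
    intro as z _ _ _ h
    simpa using h
  | cons b bs ih =>
    intro as z hl hm hr h
    have hbm : b ∈ maximalIdeal R := hm b (by simp)
    have h1 := ih (as ++ [b ^ (k + 1)]) (b ^ k • z) (by simpa using hl) ?_ ?_ ?_
    · -- split
      have h2 : Ideal.ofList (as ++ [b ^ (k+1)] ++ bs) =
          Ideal.span {b ^ (k + 1)} ⊔ Ideal.ofList (as ++ bs) := by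
        simp only [Ideal.ofList_append, Ideal.ofList_singleton]
        ac_rfl
      rw [h2, Submodule.sup_smul, Submodule.mem_sup] at h1
      obtain ⟨u, hu, w, hw, huw⟩ := h1
      rw [Submodule.ideal_span_singleton_smul, Submodule.mem_smul_pointwise_iff_exists] at hu
      obtain ⟨u, -, rfl⟩ := hu
      have h3 := H (as ++ bs ++ [b]) (by simp at hl ⊢; omega)
        (by
          intro r hr
          apply hm
          simp at hr ⊢
          tauto)
        (by
          refine hr.trans (Ideal.radical_mono ?_)
          simp only [Ideal.ofList_append, Ideal.ofList_nil, sup_bot_eq, Ideal.ofList_cons]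
          refine le_of_eq ?_
          ac_rfl)
      rw [isWeaklyRegular_append_iff, isWeaklyRegular_singleton_iff] at h3
      have h4 : b ^ k • (z - b • u) ∈ Ideal.ofList (as ++ bs) • (⊤ : Submodule R X) := by
        have : b ^ k • (z - b • u) = w := by
          rw [smul_sub, ← huw, smul_smul, ← pow_succ]
          abel
        rw [this]
        exact hw
      have h5 := mem_of_isSMulRegular_quotient_of_smul_mem (h3.2.pow k) h4
      have h6 : Ideal.ofList (as ++ b :: bs) =
          Ideal.span {b} ⊔ Ideal.ofList (as ++ bs) := by
        simp only [Ideal.ofList_append, Ideal.ofList_cons]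
        ac_rfl
      rw [h6, Submodule.sup_smul]
      have : z = b • u + (z - b • u) := by abel
      rw [this]
      refine Submodule.add_mem_sup ?_ h5
      rw [Submodule.ideal_span_singleton_smul]
      exact Submodule.smul_mem_pointwise_smul _ _ _ trivial
    · intro r hr
      simp only [List.mem_append, List.mem_singleton] at hr
      rcases hr with (hr | rfl) | hr
      · exact hm r (by simp [hr])
      · exact Ideal.pow_mem_of_mem _ hbm _ (by omega)
      · exact hm r (by simp [hr])
    · refine hr.trans ?_
      rw [Ideal.radical_le_radical_iff]
      simp only [Ideal.ofList_append, Ideal.ofList_nil, sup_bot_eq, Ideal.ofList_cons]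
      refine sup_le (le_trans ?_ Ideal.le_radical) (sup_le ?_ (le_trans ?_ Ideal.le_radical))
      · exact le_sup_left.trans le_sup_left
      · rw [Ideal.span_singleton_le_iff_mem]
        refine ⟨k + 1, ?_⟩
        exact Ideal.mem_sup_left (Ideal.mem_sup_right (Ideal.mem_span_singleton_self _))
      · exact le_sup_right
    · rw [smul_smul, ← mul_pow, mul_comm bs.prod b]
      simpa using h

/-- Solving linear equations modulo all powers of the maximal ideal. -/
lemma exists_mulVec_eq {R : Type u} [CommRing R] [IsLocalRing R] [IsNoetherianRing R]
    {ι κ : Type*} [Fintype ι] [Fintype κ] (W : Matrix ι κ R) (v : ι → R)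
    (h : ∀ n : ℕ, ∃ c : κ → R, ∀ i, v i - W.mulVec c i ∈ maximalIdeal R ^ n) :
    ∃ c : κ → R, W.mulVec c = v := by
  classical
  let Q := (ι → R) ⧸ LinearMap.range W.mulVecLin
  have hQ : (Submodule.Quotient.mk v : Q) ∈
      (⨅ n : ℕ, maximalIdeal R ^ n • ⊤ : Submodule R Q) := by
    rw [Submodule.mem_iInf]
    intro n
    obtain ⟨c, hc⟩ := h n
    have h1 : (Submodule.Quotient.mk v : Q) =
        (LinearMap.range W.mulVecLin).mkQ (v - W.mulVec c) := by
      rw [map_sub, Submodule.mkQ_apply, Submodule.mkQ_apply]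
      have : (Submodule.Quotient.mk (W.mulVec c) : Q) = 0 := by
        rw [Submodule.Quotient.mk_eq_zero]
        exact ⟨c, rfl⟩
      rw [this, sub_zero]
    have h2 : v - W.mulVec c ∈ maximalIdeal R ^ n • (⊤ : Submodule R (ι → R)) := by
      rw [pi_eq_sum_univ (v - W.mulVec c)]
      refine Submodule.sum_mem _ fun i _ => ?_
      exact Submodule.smul_mem_smul (hc i) trivial
    rw [h1]
    have h3 := Submodule.mem_map_of_mem (f := (LinearMap.range W.mulVecLin).mkQ) h2
    rw [Submodule.map_smul''] at h3
    exact Submodule.smul_mono le_rfl le_top h3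
  rw [Ideal.iInf_pow_smul_eq_bot_of_isLocalRing _ (maximalIdeal.isMaximal R).ne_top,
    Submodule.mem_bot, Submodule.Quotient.mk_eq_zero] at hQ
  obtain ⟨c, hc⟩ := hQ
  exact ⟨c, hc⟩

lemma exists_functional {R : Type u} [CommRing R] [IsLocalRing R] [IsNoetherianRing R]
    (X : Type v) [AddCommGroup X] [Module R X] [Module.Finite R X] (e : X)
    (h : ∀ n : ℕ, ∃ I : Ideal R, I ≤ maximalIdeal R ^ n ∧ ∃ f : X →ₗ[R] (R ⧸ I), f e = 1) :
    ∃ f : X →ₗ[R] R, f e = 1 := by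
  classical
  obtain ⟨b, p, hp⟩ := Module.Finite.exists_fin' R X
  obtain ⟨a, k, hk⟩ := Submodule.fg_iff_exists_fin_generating_family.mp
    (IsNoetherian.noetherian (LinearMap.ker p))
  obtain ⟨et, het⟩ := hp e
  let W : Matrix (Option (Fin a)) (Fin b) R := fun i => i.elim et k
  let v : Option (Fin a) → R := fun i => i.elim 1 (fun _ => 0)
  obtain ⟨c, hc⟩ := exists_mulVec_eq W v (by
    intro n
    obtain ⟨I, hI, f, hf⟩ := h n
    choose c hc using fun j : Fin b => Ideal.Quotient.mk_surjective (f (p (Pi.single j 1)))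
    have key : ∀ w : Fin b → R, Ideal.Quotient.mk I (w ⬝ᵥ c) = f (p w) := by
      intro w
      conv_rhs => rw [pi_eq_sum_univ w]
      simp only [dotProduct, map_sum, map_mul, map_smul, hc]
      refine Finset.sum_congr rfl fun i _ => ?_
      have : (fun j => if i = j then (1 : R) else 0) = Pi.single i 1 := by
        ext j; simp [Pi.single_apply, eq_comm]
      rw [this, Algebra.smul_def]
      rfl
    refine ⟨c, fun i => hI ?_⟩
    rw [← Ideal.Quotient.eq_zero_iff_mem, map_sub]
    cases i with
    | none =>
      have : W.mulVec c none = et ⬝ᵥ c := rfl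
      rw [this, key, het, hf]
      simp [v]
    | some i =>
      have : W.mulVec c (some i) = k i ⬝ᵥ c := rfl
      have hki : p (k i) = 0 := by
        rw [← LinearMap.mem_ker, ← hk]
        exact Submodule.subset_span ⟨i, rfl⟩
      rw [this, key, hki]
      simp [v])
  let F : (Fin b → R) →ₗ[R] R := dotProductBilin R R |>.flip c
  have hF : ∀ w, F w = w ⬝ᵥ c := fun w => rfl
  have hker : LinearMap.ker p ≤ LinearMap.ker F := by
    rw [← hk, Submodule.span_le]
    rintro _ ⟨i, rfl⟩
    exact congrFun hc (some i)
  let q := LinearMap.quotKerEquivOfSurjective p hp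
  refine ⟨(LinearMap.ker p).liftQ F hker ∘ₗ q.symm.toLinearMap, ?_⟩
  have : q.symm e = Submodule.Quotient.mk et := by
    rw [LinearEquiv.symm_apply_eq, ← het]
    rfl
  simp only [LinearMap.comp_apply, LinearEquiv.coe_coe, this]
  exact congrFun hc none

lemma one_le_freeRank {R : Type u} [CommRing R] [Nontrivial R]
    (X : Type v) [AddCommGroup X] [Module R X] [Module.Finite R X] (e : X)
    (f : X →ₗ[R] R) (hf : f e = 1) : 1 ≤ freeRank R X := by
  obtain ⟨b, p, hp⟩ := Module.Finite.exists_fin' R X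
  refine le_csSup ⟨b, ?_⟩ ?_
  · rintro n ⟨f, g, hfg⟩
    have hs : Function.Surjective (f ∘ₗ p) := by
      refine Function.Surjective.comp (g := f) ?_ hp
      intro y
      exact ⟨g y, LinearMap.congr_fun hfg y⟩
    exact le_of_fin_surjective R _ hs
  · refine ⟨LinearMap.pi fun _ => f, (LinearMap.toSpanSingleton R X e) ∘ₗ LinearMap.proj 0, ?_⟩
    ext i j
    simp [hf, Subsingleton.elim i 0, Subsingleton.elim j 0]

lemma freeRank_self {R : Type u} [CommRing R] [Nontrivial R] : freeRank R R = 1 := by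
  apply le_antisymm
  · refine csSup_le ⟨0, 0, 0, by ext i; exact i.elim0⟩ ?_
    rintro n ⟨f, g, hfg⟩
    have hs : Function.Surjective (f ∘ₗ (LinearMap.proj 0 : (Fin 1 → R) →ₗ[R] R)) := by
      refine Function.Surjective.comp (g := f) ?_ ?_
      · intro y
        exact ⟨g y, LinearMap.congr_fun hfg y⟩
      · intro y
        exact ⟨fun _ => y, rfl⟩
    exact le_of_fin_surjective R _ hs
  · exact one_le_freeRank R 1 LinearMap.id rfl

section Duality

lemma length_hom_add_le {R : Type*} [CommRing R] {K M N A : Type*} [AddCommGroup K] [Module R K]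
    [AddCommGroup M] [Module R M] [AddCommGroup N] [Module R N] [AddCommGroup A] [Module R A]
    (i : K →ₗ[R] M) (p : M →ₗ[R] N) (hp : Function.Surjective p) (hip : Function.Exact i p) :
    Module.length R (M →ₗ[R] A) ≤ Module.length R (N →ₗ[R] A) + Module.length R (K →ₗ[R] A) := by
  let r : (M →ₗ[R] A) →ₗ[R] (K →ₗ[R] A) := LinearMap.lcomp R A i
  let s : (N →ₗ[R] A) →ₗ[R] (M →ₗ[R] A) := LinearMap.lcomp R A p
  have h1 := Module.length_eq_add_of_exact (LinearMap.ker r).subtype r.rangeRestrict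
    (Submodule.subtype_injective _) r.surjective_rangeRestrict (by
      intro x
      rw [Submodule.coe_subtype, Subtype.range_coe_subtype, Set.mem_ofPred_eq, LinearMap.mem_ker]
      constructor
      · intro h; exact congrArg Subtype.val h
      · intro h; exact Subtype.ext h)
  rw [h1]
  refine add_le_add ?_ (Module.length_le_of_injective (Submodule.subtype _)
    (Submodule.subtype_injective _))
  -- the kernel of `r` is contained in the range of `s`
  have h2 : LinearMap.ker r ≤ LinearMap.range s := by
    intro f hf
    have hker : LinearMap.ker p ≤ LinearMap.ker f := by
      intro x hx
      obtain ⟨y, rfl⟩ := (hip x).mp hx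
      exact LinearMap.congr_fun hf y
    let q := LinearMap.quotKerEquivOfSurjective p hp
    refine ⟨(LinearMap.ker p).liftQ f hker ∘ₗ q.symm.toLinearMap, ?_⟩
    ext x
    have : q.symm (p x) = Submodule.Quotient.mk x := by
      rw [LinearEquiv.symm_apply_eq]; rfl
    simp [s, this]
  have h3 := Module.length_le_of_injective (Submodule.inclusion h2)
    (Submodule.inclusion_injective h2)
  exact h3.trans (Module.length_le_of_surjective s.rangeRestrict s.surjective_rangeRestrict)

lemma length_hom_le {R : Type*} [CommRing R] [IsLocalRing R] {A : Type*} [AddCommGroup A]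
    [Module R A] (hA : Module.length R ((R ⧸ maximalIdeal R) →ₗ[R] A) ≤ 1)
    {M : Type*} [AddCommGroup M] [Module R M] (hM : IsFiniteLength R M) :
    Module.length R (M →ₗ[R] A) ≤ Module.length R M := by
  induction hM with
  | of_subsingleton =>
    rw [Module.length_eq_zero_iff.mpr]
    · exact zero_le
    · refine ⟨fun f g => ?_⟩
      ext x
      rw [Subsingleton.elim x 0, map_zero, map_zero]
  | @of_simple_quotient M _ _ N hs _ ih =>
    refine (length_hom_add_le N.subtype N.mkQ N.mkQ_surjective
      (LinearMap.exact_subtype_mkQ N)).trans ?_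
    rw [Module.length_eq_add_of_exact N.subtype N.mkQ N.subtype_injective N.mkQ_surjective
      (LinearMap.exact_subtype_mkQ N), add_comm]
    refine add_le_add ih ?_
    rw [Module.length_eq_one _ (M ⧸ N)]
    obtain ⟨I, hI, ⟨ψ⟩⟩ := isSimpleModule_iff_quot_maximal.mp hs
    obtain rfl := IsLocalRing.eq_maximalIdeal hI
    rwa [LinearEquiv.length_eq (LinearEquiv.congrLeft A R ψ)]

lemma exists_hom_ne_zero {R : Type*} [CommRing R] [IsLocalRing R] (I : Ideal R)
    [IsNoetherian R (R ⧸ I)] [IsArtinian R (R ⧸ I)]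
    (hA : Module.length R ((R ⧸ maximalIdeal R) →ₗ[R] (R ⧸ I)) ≤ 1)
    {M : Type*} [AddCommGroup M] [Module R M] [Module.Finite R M]
    (hI : I ≤ Module.annihilator R M) (z : M) (hz : z ≠ 0) :
    ∃ f : M →ₗ[R] (R ⧸ I), f z ≠ 0 := by
  classical
  obtain ⟨b, p₀, hp₀⟩ := Module.Finite.exists_fin' R M
  -- a surjection from a free `R/I`-module
  have hgen : ∃ p : (Fin b → R ⧸ I) →ₗ[R] M, Function.Surjective p := by
    let t : Fin b → ((R ⧸ I) →ₗ[R] M) := fun j =>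
      Submodule.liftQ I (LinearMap.toSpanSingleton R M (p₀ (Pi.single j 1))) (by
        intro r hr
        exact Module.mem_annihilator.mp (hI hr) _)
    refine ⟨LinearMap.lsum R (fun _ => R ⧸ I) R t, ?_⟩
    intro m
    obtain ⟨w, rfl⟩ := hp₀ m
    refine ⟨fun j => Ideal.Quotient.mk I (w j), ?_⟩
    rw [LinearMap.lsum_apply, LinearMap.sum_apply]
    conv_rhs => rw [pi_eq_sum_univ w, map_sum]
    refine Finset.sum_congr rfl fun i _ => ?_
    have : (fun j => if i = j then (1 : R) else 0) = Pi.single i 1 := by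
      ext j; simp [Pi.single_apply, eq_comm]
    rw [this, map_smul]
    rfl
  obtain ⟨p, hp⟩ := hgen
  have hMA : IsArtinian R M := isArtinian_of_surjective _ p hp
  have hMN : IsNoetherian R M := isNoetherian_of_surjective p (LinearMap.range_eq_top.mpr hp)
  have hK : IsFiniteLength R (LinearMap.ker p) :=
    isFiniteLength_iff_isNoetherian_isArtinian.mpr ⟨inferInstance, inferInstance⟩
  have hex : Function.Exact (LinearMap.ker p).subtype p := LinearMap.exact_subtype_ker_map p
  -- lower bound for the length of the dual
  have hlow : Module.length R (Fin b → R ⧸ I) ≤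
      Module.length R ((Fin b → R ⧸ I) →ₗ[R] (R ⧸ I)) := by
    let D : (Fin b → R ⧸ I) →ₗ[R] ((Fin b → R ⧸ I) →ₗ[R] (R ⧸ I)) :=
      LinearMap.mk₂ R (fun v w => v ⬝ᵥ w) (fun _ _ _ => add_dotProduct _ _ _)
        (fun _ _ _ => smul_dotProduct _ _ _) (fun _ _ _ => dotProduct_add _ _ _)
        (fun _ _ _ => dotProduct_smul _ _ _)
    refine Module.length_le_of_injective D ?_
    intro v w hvw
    ext i
    have := LinearMap.congr_fun hvw (Pi.single i 1)
    simpa [D] using this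
  have h1 := length_hom_add_le (A := R ⧸ I) _ p hp hex
  have h2 := length_hom_le hA hK
  have h3 := Module.length_eq_add_of_exact _ p (Submodule.subtype_injective _) hp hex
  have hKt : Module.length R (LinearMap.ker p) ≠ ⊤ := Module.length_ne_top
  have h4 : Module.length R M ≤ Module.length R (M →ₗ[R] (R ⧸ I)) := by
    have h5 : Module.length R (LinearMap.ker p) + Module.length R M ≤
        Module.length R (LinearMap.ker p) + Module.length R (M →ₗ[R] (R ⧸ I)) := by
      rw [← h3]
      refine hlow.trans (h1.trans ?_)
      rw [add_comm]
      gcongr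
    exact (ENat.add_le_add_iff_left hKt).mp h5
  by_contra! hcon
  let N := Submodule.span R {z}
  have hN : N ≠ ⊥ := by simpa [N] using hz
  have h6 := Submodule.length_quotient_lt N hN
  have hQ : IsFiniteLength R (M ⧸ N) :=
    isFiniteLength_iff_isNoetherian_isArtinian.mpr ⟨inferInstance, inferInstance⟩
  have h7 := length_hom_le hA hQ
  have h8 : Module.length R (M →ₗ[R] (R ⧸ I)) ≤ Module.length R ((M ⧸ N) →ₗ[R] (R ⧸ I)) := by
    refine Module.length_le_of_surjective (LinearMap.lcomp R (R ⧸ I) N.mkQ) ?_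
    intro f
    refine ⟨N.liftQ f ?_, ?_⟩
    · rw [Submodule.span_le, Set.singleton_subset_iff]
      exact hcon f
    · ext x
      simp
  exact absurd (h4.trans (h8.trans h7)) (not_le.mpr h6)

lemma length_residue_hom_le {R : Type u} [CommRing R] [IsLocalRing R] (I : Ideal R)
    (h : mLength R (idealQuot (I.colon (maximalIdeal R)) I) = 1) :
    Module.length R ((R ⧸ maximalIdeal R) →ₗ[R] (R ⧸ I)) ≤ 1 := by
  have hl : Module.length R (idealQuot (I.colon (maximalIdeal R)) I) = 1 := by
    rw [mLength, ← Module.coe_length] at h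
    exact_mod_cast h
  rw [← hl]
  let C : Ideal R := I.colon (maximalIdeal R)
  let S : Submodule R (R ⧸ I) := Submodule.map (Submodule.mkQ I) C
  let g : idealQuot C I →ₗ[R] S := Submodule.liftQ _
    (LinearMap.codRestrict S ((Submodule.mkQ I) ∘ₗ C.subtype)
      (fun c => Submodule.mem_map_of_mem c.2)) (by
        intro c hc
        apply Subtype.ext
        exact (Submodule.Quotient.mk_eq_zero I).mpr hc)
  have hg : Function.Surjective g := by
    rintro ⟨_, c, hc, rfl⟩
    exact ⟨Submodule.Quotient.mk ⟨c, hc⟩, rfl⟩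
  refine le_trans ?_ (Module.length_le_of_surjective g hg)
  let ev : ((R ⧸ maximalIdeal R) →ₗ[R] (R ⧸ I)) →ₗ[R] S :=
    LinearMap.codRestrict S (LinearMap.applyₗ (1 : R ⧸ maximalIdeal R)) (by
      intro f
      obtain ⟨c, hc⟩ := Submodule.Quotient.mk_surjective I (f 1)
      refine ⟨c, ?_, hc⟩
      show c ∈ I.colon (maximalIdeal R)
      rw [Submodule.mem_colon]
      intro r hr
      rw [← Submodule.Quotient.mk_eq_zero I, smul_eq_mul, mul_comm, ← smul_eq_mul,
        Submodule.Quotient.mk_smul, hc, ← map_smul]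
      have : r • (1 : R ⧸ maximalIdeal R) = 0 := by
        rw [Algebra.smul_def, mul_one]
        exact Ideal.Quotient.eq_zero_iff_mem.mpr hr
      rw [this, map_zero])
  refine Module.length_le_of_injective ev ?_
  intro f f' hff
  have h1 : f 1 = f' 1 := congrArg Subtype.val hff
  ext
  exact h1

end Duality

lemma isArtinian_quotient {R : Type u} [CommRing R] [IsLocalRing R] [IsNoetherianRing R]
    (I : Ideal R) (h : maximalIdeal R ≤ I.radical) : IsArtinian R (R ⧸ I) := by
  have : IsArtinianRing (R ⧸ I) := by
    rw [isArtinianRing_iff_isNoetherianRing_krullDimLE_zero]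
    refine ⟨inferInstance, Ring.krullDimLE_zero_iff.mpr ?_⟩
    intro P hP
    have hc : (P.comap (Ideal.Quotient.mk I)).IsPrime := Ideal.comap_isPrime _ _
    have h1 : I ≤ P.comap (Ideal.Quotient.mk I) := by
      intro x hx
      rw [Ideal.mem_comap, Ideal.Quotient.eq_zero_iff_mem.mpr hx]
      exact P.zero_mem
    have h2 : P.comap (Ideal.Quotient.mk I) = maximalIdeal R := by
      apply le_antisymm (IsLocalRing.le_maximalIdeal hc.ne_top)
      exact h.trans (hc.radical_le_iff.mpr h1)
    have h3 : (P.comap (Ideal.Quotient.mk I)).IsMaximal := by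
      rw [h2]; infer_instance
    rcases Ideal.map_eq_top_or_isMaximal_of_surjective (Ideal.Quotient.mk I)
      Ideal.Quotient.mk_surjective h3 with h | h
    · rw [Ideal.map_comap_of_surjective _ Ideal.Quotient.mk_surjective] at h
      exact absurd h hP.ne_top
    · rwa [Ideal.map_comap_of_surjective _ Ideal.Quotient.mk_surjective] at h
  exact isArtinian_of_surjective_algebraMap (R := R ⧸ I) Ideal.Quotient.mk_surjective

lemma maximalIdeal_le_radical_of_regular {R : Type u} [CommRing R] [IsLocalRing R]
    [IsNoetherianRing R] (rs : List R)
    (hreg : RingTheory.Sequence.IsRegular R rs)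
    (hlen : (rs.length : WithBot ℕ∞) = ringKrullDim R) :
    maximalIdeal R ≤ (Ideal.ofList rs).radical := by
  have h1 := ringKrullDim_add_length_eq_ringKrullDim_of_isRegular rs hreg
  rw [← hlen] at h1
  have h2 : ringKrullDim (R ⧸ Ideal.ofList rs) ≤ 0 := by
    generalize ringKrullDim (R ⧸ Ideal.ofList rs) = a at h1
    induction a with
    | bot => exact bot_le
    | coe a =>
      have h3 : a + (rs.length : ℕ∞) = (rs.length : ℕ∞) := by exact_mod_cast h1
      have h4 : a = 0 := by
        have : (rs.length : ℕ∞) + a ≤ rs.length + 0 := by rw [add_comm, h3, add_zero]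
        exact le_antisymm ((ENat.add_le_add_iff_left (ENat.natCast_ne_top _)).mp this) zero_le
      rw [h4]
      exact le_rfl
  have h3 : Ring.KrullDimLE 0 (R ⧸ Ideal.ofList rs) := by
    rw [Ring.krullDimLE_iff]
    exact_mod_cast h2
  rw [Ring.krullDimLE_zero_iff] at h3
  rw [Ideal.radical_eq_sInf]
  refine le_sInf ?_
  rintro P ⟨hP, hPp⟩
  have h4 : (P.map (Ideal.Quotient.mk (Ideal.ofList rs))).IsPrime :=
    Ideal.map_isPrime_of_surjective Ideal.Quotient.mk_surjective (by rwa [Ideal.mk_ker])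
  have h5 := h3 _ h4
  have h6 : P = (P.map (Ideal.Quotient.mk (Ideal.ofList rs))).comap
      (Ideal.Quotient.mk (Ideal.ofList rs)) := by
    rw [Ideal.comap_map_of_surjective _ Ideal.Quotient.mk_surjective, ← RingHom.ker_eq_comap_bot,
      Ideal.mk_ker, sup_eq_left.mpr hP]
  have h7 : P.IsMaximal := by
    rw [h6]
    exact Ideal.comap_isMaximal_of_surjective _ Ideal.Quotient.mk_surjective
  rw [IsLocalRing.eq_maximalIdeal h7]

lemma isWeaklyRegular_of_isMCM {R : Type u} [CommRing R] [IsLocalRing R] [IsNoetherianRing R]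
    (X : Type u) [AddCommGroup X] [Module R X] [Module.Finite R X] (hX : IsMCM R X)
    (zs : List R) (hlen : (zs.length : WithBot ℕ∞) = ringKrullDim R)
    (hm : ∀ r ∈ zs, r ∈ maximalIdeal R) (hr : maximalIdeal R ≤ (Ideal.ofList zs).radical) :
    RingTheory.Sequence.IsWeaklyRegular X zs := by
  obtain ⟨ys, hym, hyr, hyl⟩ := hX
  have : Nontrivial X := hyr.nontrivial
  refine isWeaklyRegular_of_sop zs X hm (hr.trans (Ideal.radical_mono le_sup_left))
    ⟨ys, ?_, hym, hyr⟩
  rw [← hlen] at hyl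
  exact_mod_cast hyl

open Pointwise in
theorem one_le_freeRank_of_surjective {R : Type u} [CommRing R] [IsLocalRing R]
    [IsNoetherianRing R] (hGor : IsGorensteinLocalRing R)
    (rs : List R) (hrs : ∀ r ∈ rs, r ∈ maximalIdeal R)
    (hr : maximalIdeal R ≤ (Ideal.ofList rs).radical)
    (hlen : (rs.length : WithBot ℕ∞) = ringKrullDim R)
    (J : Ideal R) (hJ : J ≤ Ideal.ofList rs)
    (X : Type u) [AddCommGroup X] [Module R X] [Module.Finite R X] (hX : IsMCM R X)
    (φ : X →ₗ[R] (R ⧸ J)) (hφ : Function.Surjective φ) : 1 ≤ freeRank R X := by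
  -- regularity of systems of parameters
  have HR : ∀ zs : List R, zs.length = rs.length → (∀ r ∈ zs, r ∈ maximalIdeal R) →
      maximalIdeal R ≤ (Ideal.ofList zs).radical →
      mLength R (idealQuot ((Ideal.ofList zs).colon (maximalIdeal R)) (Ideal.ofList zs)) = 1 := by
    intro zs hl hm hz
    refine hGor.2 zs hm ?_ (by rw [hl, hlen])
    exact RingTheory.Sequence.IsRegular.of_isWeaklyRegular_of_mem_maximalIdeal R hm
      (isWeaklyRegular_of_isMCM R hGor.1 zs (by rw [hl, hlen]) hm hz)
  have HX : ∀ zs : List R, zs.length = rs.length → (∀ r ∈ zs, r ∈ maximalIdeal R) →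
      maximalIdeal R ≤ (Ideal.ofList zs).radical → RingTheory.Sequence.IsWeaklyRegular X zs :=
    fun zs hl hm hz => isWeaklyRegular_of_isMCM X hX zs (by rw [hl, hlen]) hm hz
  -- a socle element
  obtain ⟨s, hsc, hs⟩ : ∃ s ∈ (Ideal.ofList rs).colon (maximalIdeal R : Set R),
      s ∉ Ideal.ofList rs := by
    by_contra! hcon
    have h1 := HR rs rfl hrs hr
    have : Subsingleton (idealQuot ((Ideal.ofList rs).colon (maximalIdeal R))
        (Ideal.ofList rs)) := by
      rw [Submodule.Quotient.subsingleton_iff, eq_top_iff]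
      intro c _
      exact hcon c c.2
    rw [mLength, ← Module.coe_length, Module.length_eq_zero] at h1
    exact absurd h1 (by norm_cast)
  obtain ⟨e, he⟩ := hφ 1
  have hse : s • e ∉ Ideal.ofList rs • (⊤ : Submodule R X) := by
    intro hmem
    let ψ : X →ₗ[R] (R ⧸ Ideal.ofList rs) := (Submodule.factor hJ) ∘ₗ φ
    have h1 : ψ e = 1 := by
      show Submodule.factor hJ (φ e) = 1
      rw [he]
      rfl
    have h2 := Submodule.mem_map_of_mem (f := ψ) hmem
    rw [Submodule.map_smul''] at h2
    have h3 : Ideal.ofList rs • (Submodule.map ψ ⊤) ≤ ⊥ := by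
      rw [Submodule.smul_le]
      intro r hr n _
      obtain ⟨n, rfl⟩ := Ideal.Quotient.mk_surjective n
      rw [Submodule.mem_bot, Algebra.smul_def]
      have : algebraMap R (R ⧸ Ideal.ofList rs) r = 0 := Ideal.Quotient.eq_zero_iff_mem.mpr hr
      rw [this, zero_mul]
    have h4 := h3 h2
    rw [Submodule.mem_bot, map_smul, h1, Algebra.smul_def, mul_one] at h4
    exact hs (Ideal.Quotient.eq_zero_iff_mem.mp h4)
  obtain ⟨f, hf⟩ := exists_functional X e (by
    intro n
    set zs := rs.map (· ^ (n + 1)) with hzs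
    have hzm : ∀ r ∈ zs, r ∈ maximalIdeal R := by
      intro r hr
      obtain ⟨t, ht, rfl⟩ := List.mem_map.mp hr
      exact Ideal.pow_mem_of_mem _ (hrs t ht) _ (by omega)
    have hzr : maximalIdeal R ≤ (Ideal.ofList zs).radical := by
      refine hr.trans ?_
      rw [Ideal.radical_le_radical_iff]
      refine Ideal.span_le.mpr ?_
      intro r hr
      exact ⟨n + 1, Ideal.subset_span (List.mem_map.mpr ⟨r, hr, rfl⟩)⟩
    set I := Ideal.ofList zs with hI
    refine ⟨I, ?_, ?_⟩
    · refine Ideal.span_le.mpr ?_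
      intro r hr
      obtain ⟨t, ht, rfl⟩ := List.mem_map.mp hr
      exact Ideal.pow_le_pow_right (by omega) (Ideal.pow_mem_pow (hrs t ht) (n + 1))
    have hart := isArtinian_quotient I hzr
    have hA := length_residue_hom_le I (HR zs (by simp [hzs]) hzm hzr)
    let M := X ⧸ (I • (⊤ : Submodule R X))
    have hann : I ≤ Module.annihilator R M := by
      intro r hr
      rw [Module.mem_annihilator]
      intro q
      obtain ⟨q, rfl⟩ := Submodule.Quotient.mk_surjective _ q
      rw [← Submodule.Quotient.mk_smul, Submodule.Quotient.mk_eq_zero]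
      exact Submodule.smul_mem_smul hr trivial
    have hz : (Submodule.Quotient.mk (rs.prod ^ n • s • e) : M) ≠ 0 := by
      rw [Ne, Submodule.Quotient.mk_eq_zero]
      intro hmem
      exact hse (mem_of_prod_pow_smul_mem X rs.length HX n rs [] (s • e) rfl hrs hr hmem)
    obtain ⟨g, hg⟩ := exists_hom_ne_zero I hA hann _ hz
    obtain ⟨a, ha⟩ := Ideal.Quotient.mk_surjective (g (Submodule.Quotient.mk e))
    have hau : IsUnit a := by
      by_contra hna
      have ham : a ∈ maximalIdeal R := hna
      apply hg
      rw [smul_smul, Submodule.Quotient.mk_smul, map_smul, ← ha, Algebra.smul_def]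
      have hsa : s * a ∈ Ideal.ofList rs := Submodule.mem_colon.mp hsc a ham
      have hle : ∀ y ∈ Ideal.ofList rs, rs.prod ^ n * y ∈ I := by
        intro y hy
        have : Ideal.ofList rs ≤ Submodule.comap (LinearMap.lsmul R R (rs.prod ^ n)) I := by
          refine Ideal.span_le.mpr ?_
          intro r hr
          show rs.prod ^ n * r ∈ I
          have hd : r ^ (n + 1) ∣ rs.prod ^ n * r := by
            rw [pow_succ]
            exact mul_dvd_mul_right (pow_dvd_pow_of_dvd (List.dvd_prod hr) n) r
          exact I.mem_of_dvd hd (Ideal.subset_span (List.mem_map.mpr ⟨r, hr, rfl⟩))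
        exact this hy
      have h5 := hle _ hsa
      rw [← mul_assoc] at h5
      exact Ideal.Quotient.eq_zero_iff_mem.mpr h5
    obtain ⟨u, hu⟩ := hau.exists_left_inv
    refine ⟨u • (g ∘ₗ Submodule.mkQ _), ?_⟩
    rw [LinearMap.smul_apply, LinearMap.comp_apply, Submodule.mkQ_apply, ← ha, Algebra.smul_def]
    show Ideal.Quotient.mk I u * Ideal.Quotient.mk I a = 1
    rw [← map_mul, hu, map_one])
  exact one_le_freeRank X e f hf

lemma auslanderDelta_eq_one {R : Type u} [CommRing R] [IsLocalRing R]
    [IsNoetherianRing R] (hGor : IsGorensteinLocalRing R)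
    (rs : List R) (hrs : ∀ r ∈ rs, r ∈ maximalIdeal R)
    (hr : maximalIdeal R ≤ (Ideal.ofList rs).radical)
    (hlen : (rs.length : WithBot ℕ∞) = ringKrullDim R)
    (J : Ideal R) (hJ : J ≤ Ideal.ofList rs) : auslanderDelta R (R ⧸ J) = 1 := by
  have hmem : 1 ∈ {r : ℕ | ∃ X : ModuleCat.{u} R, Module.Finite R X ∧ IsMCM R X ∧
    (∃ φ : X →ₗ[R] (R ⧸ J), Function.Surjective φ) ∧ freeRank R X = r} :=
    ⟨ModuleCat.of R R, inferInstanceAs (Module.Finite R R), hGor.1,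
      ⟨Submodule.mkQ J, Submodule.mkQ_surjective J⟩, freeRank_self⟩
  apply le_antisymm
  · exact Nat.sInf_le hmem
  · refine le_csInf ⟨1, hmem⟩ ?_
    rintro r ⟨X, hfin, hX, ⟨φ, hφ⟩, rfl⟩
    exact one_le_freeRank_of_surjective hGor rs hrs hr hlen J hJ X hX φ hφ

/-- If `(R,m)` is a Gorenstein local ring and `x₁,…,x_d` is a maximal
regular sequence, then `δ(R/(x₁,…,x_d)) = 1`; consequently if `mⁿ ⊆ (x₁,…,x_d)` then
`δ(R/mⁿ) = 1`, and `index(R) ≤ gℓℓ(R)`. -/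
theorem auslanderDelta_quotient_regular_sequence_eq_one
    (R : Type u) [CommRing R] [IsLocalRing R] [IsNoetherianRing R]
    (hGor : IsGorensteinLocalRing R)
    (rs : List R) (hrs : ∀ r ∈ rs, r ∈ IsLocalRing.maximalIdeal R)
    (hreg : RingTheory.Sequence.IsRegular R rs)
    (hlen : (rs.length : WithBot ℕ∞) = ringKrullDim R) :
    auslanderDelta R (R ⧸ Ideal.ofList rs) = 1 ∧
      (∀ n : ℕ, IsLocalRing.maximalIdeal R ^ n ≤ Ideal.ofList rs →
        auslanderDelta R (R ⧸ (IsLocalRing.maximalIdeal R ^ n)) = 1) ∧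
      ringIndex R ≤ gll R := by
  have hr := maximalIdeal_le_radical_of_regular rs hreg hlen
  refine ⟨auslanderDelta_eq_one hGor rs hrs hr hlen _ le_rfl,
    fun n hn => auslanderDelta_eq_one hGor rs hrs hr hlen _ hn, ?_⟩
  refine sInf_le_sInf (Set.image_mono ?_)
  rintro n ⟨zs, hzm, hzl, hzn⟩
  refine auslanderDelta_eq_one hGor zs hzm ?_ hzl _ hzn
  intro x hx
  exact ⟨n, hzn (Ideal.pow_mem_pow hx n)⟩
end

section
/- Let (R,m,k) be a one-dimensional Gorenstein local ring and x ∈ m a non zero-divisor. For n ≥ 1, δ(R/m^n) = 1 if and only if x m^n : m ⊆ (x). -/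
open IsLocalRing

universe u v

section Helpers

variable {R : Type u} [CommRing R]

theorem aux_isRegular_singleton [IsLocalRing R] {M : Type v} [AddCommGroup M] [Module R M]
    [Module.Finite R M] [Nontrivial M] {w : R} (hw : w ∈ maximalIdeal R)
    (hreg : IsSMulRegular M w) : RingTheory.Sequence.IsRegular M [w] := by
  refine ⟨(RingTheory.Sequence.isWeaklyRegular_singleton_iff M w).mpr hreg, ?_⟩
  intro h
  have h2 : (⊤ : Submodule R M) ≤ ⊥ := by
    apply Submodule.le_of_le_smul_of_le_jacobson_bot (I := Ideal.ofList [w])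
      Module.Finite.fg_top
    · refine le_trans ?_ (IsLocalRing.maximalIdeal_le_jacobson _)
      simpa [Ideal.ofList_singleton, Ideal.span_le] using hw
    · rw [bot_sup_eq]; exact h.le
  exact top_ne_bot (le_bot_iff.mp h2)

theorem aux_finiteLength_quot [IsLocalRing R] [IsNoetherianRing R] (hdim : ringKrullDim R = 1)
    {w : R} (hw : w ∈ nonZeroDivisors R) : IsFiniteLength R (R ⧸ Ideal.span {w}) := by
  have h := ringKrullDim_quotient_succ_le_of_nonZeroDivisor hw
  rw [hdim] at h
  have h0 : ringKrullDim (R ⧸ Ideal.span {w}) ≤ 0 := by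
    generalize ringKrullDim (R ⧸ Ideal.span {w}) = d at h
    induction d with
    | bot => simp
    | coe d =>
      have h' : d + 1 ≤ 1 := by exact_mod_cast h
      have : d ≤ 0 := by
        have h'' : d + 1 ≤ 0 + 1 := by rw [zero_add]; exact h'
        exact (ENat.add_le_add_iff_right ENat.one_ne_top).mp h''
      exact_mod_cast this
  have : Ring.KrullDimLE 0 (R ⧸ Ideal.span {w}) := Order.krullDimLE_iff _ _ |>.mpr (by exact_mod_cast h0)
  have hA : IsArtinianRing (R ⧸ Ideal.span {w}) :=
    isArtinianRing_iff_krullDimLE_zero.mpr this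
  rw [isFiniteLength_iff_isNoetherian_isArtinian]
  refine ⟨inferInstance, ?_⟩
  exact isArtinian_of_surjective_algebraMap (M := R ⧸ Ideal.span {w})
    (S := R) (R := R ⧸ Ideal.span {w}) Ideal.Quotient.mk_surjective

theorem aux_pow_mem [IsLocalRing R] [IsNoetherianRing R] (hdim : ringKrullDim R = 1)
    {w : R} (hw : w ∈ nonZeroDivisors R) {z : R} (hz : z ∈ maximalIdeal R) :
    ∃ N : ℕ, z ^ N ∈ Ideal.span {w} := by
  obtain ⟨_, _⟩ := isFiniteLength_iff_isNoetherian_isArtinian.mp (aux_finiteLength_quot hdim hw)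
  obtain ⟨N, y, hy⟩ := IsArtinian.exists_pow_succ_smul_dvd z (1 : R ⧸ Ideal.span {w})
  obtain ⟨y, rfl⟩ := Ideal.Quotient.mk_surjective y
  refine ⟨N, ?_⟩
  have h1 : z ^ (N + 1) * y - z ^ N * 1 ∈ Ideal.span {w} := by
    rw [← Ideal.Quotient.mk_eq_mk_iff_sub_mem]
    exact hy
  have hu : IsUnit (1 - z * y) := by
    have : z * y ∈ maximalIdeal R := Ideal.mul_mem_right _ _ hz
    exact IsLocalRing.isUnit_one_sub_self_of_mem_nonunits _ this
  obtain ⟨v, hv⟩ := hu.exists_right_inv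
  have h2 : z ^ N = -v * (z ^ (N + 1) * y - z ^ N * 1) := by
    linear_combination (-z ^ N) * hv
  rw [h2]
  exact Ideal.mul_mem_left _ _ h1

theorem aux_hom_simple_le [IsLocalRing R] {A : Type u} [AddCommGroup A] [Module R A]
    (Z : Submodule R A) (hZ : Module.length R Z ≤ 1)
    (hZ' : ∀ a : A, (∀ r ∈ maximalIdeal R, r • a = 0) → a ∈ Z)
    (S : Type u) [AddCommGroup S] [Module R S] [IsSimpleModule R S] :
    Module.length R (S →ₗ[R] A) ≤ 1 := by
  have := IsSimpleModule.nontrivial R S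
  obtain ⟨s, hs⟩ := exists_ne (0 : S)
  have hspan : Submodule.span R {s} = ⊤ := by
    apply (eq_bot_or_eq_top _).resolve_left
    simpa using hs
  have hms : ∀ r ∈ maximalIdeal R, r • s = 0 := by
    intro r hr
    have h1 := IsSemisimpleModule.jacobson_le_annihilator R S
    have h2 := h1 (show r ∈ Ring.jacobson R by
      rw [← Ideal.jacobson_bot]; exact IsLocalRing.maximalIdeal_le_jacobson (R := R) ⊥ hr)
    exact Module.mem_annihilator.mp h2 s
  let e : (S →ₗ[R] A) →ₗ[R] Z :=
    LinearMap.codRestrict Z (LinearMap.applyₗ s) (fun f => hZ' _ (fun r hr => by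
      simp only [LinearMap.applyₗ_apply_apply]
      rw [← map_smul, hms r hr, map_zero]))
  refine le_trans (Module.length_le_of_injective e ?_) hZ
  intro f g hfg
  have h3 : f s = g s := congrArg Subtype.val hfg
  apply LinearMap.ext_on hspan
  rintro t rfl
  exact h3

theorem aux_length_hom_add {A : Type u} [AddCommGroup A] [Module R A]
    (M : Type u) [AddCommGroup M] [Module R M] (N : Submodule R M) :
    Module.length R (M →ₗ[R] A) = Module.length R ((M ⧸ N) →ₗ[R] A) +
      Module.length R (LinearMap.range (LinearMap.lcomp R A N.subtype)) := by
  apply Module.length_eq_add_of_exact (LinearMap.lcomp R A N.mkQ)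
    (LinearMap.lcomp R A N.subtype).rangeRestrict
  · intro f g h
    apply LinearMap.ext
    intro y
    obtain ⟨y, rfl⟩ := N.mkQ_surjective y
    exact LinearMap.congr_fun h y
  · exact LinearMap.surjective_rangeRestrict _
  · intro f
    constructor
    · intro h
      have h' : f ∘ₗ N.subtype = 0 := congrArg Subtype.val h
      refine ⟨N.liftQ f ?_, ?_⟩
      · intro y hy
        exact LinearMap.congr_fun h' ⟨y, hy⟩
      · exact N.liftQ_mkQ f (fun y hy => LinearMap.congr_fun h' ⟨y, hy⟩)
    · rintro ⟨g, rfl⟩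
      apply Subtype.ext
      apply LinearMap.ext
      intro y
      change g (Submodule.Quotient.mk (y : M)) = 0
      rw [(Submodule.Quotient.mk_eq_zero N).mpr y.2, map_zero]

theorem aux_length_hom_le {A : Type u} [AddCommGroup A] [Module R A]
    (hS : ∀ (S : Type u) [AddCommGroup S] [Module R S] [IsSimpleModule R S],
      Module.length R (S →ₗ[R] A) ≤ 1)
    (M : Type u) [AddCommGroup M] [Module R M] (hM : IsFiniteLength R M) :
    Module.length R (M →ₗ[R] A) ≤ Module.length R M := by
  induction hM with
  | of_subsingleton => 
    have : Subsingleton (‹Type u› →ₗ[R] A) := inferInstance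
    simp
  | @of_simple_quotient M _ _ N _ hN ih =>
    rw [aux_length_hom_add M N, Module.length_eq_add_of_exact N.subtype N.mkQ N.subtype_injective
      N.mkQ_surjective (LinearMap.exact_subtype_mkQ N), add_comm]
    gcongr
    · exact (Module.length_le_of_injective (Submodule.subtype _)
        (Submodule.subtype_injective _)).trans ih
    · rw [Module.length_eq_one (R := R) (M := M ⧸ N)]
      exact hS _

theorem aux_extend (I : Ideal R) (hI : IsFiniteLength R (R ⧸ I))
    (hS : ∀ (S : Type u) [AddCommGroup S] [Module R S] [IsSimpleModule R S],
      Module.length R (S →ₗ[R] (R ⧸ I)) ≤ 1)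
    (r : ℕ) {K : Type u} [AddCommGroup K] [Module R K] (i : K →ₗ[R] (Fin r → R ⧸ I))
    (h : K →ₗ[R] (R ⧸ I)) (hih : LinearMap.ker i ≤ LinearMap.ker h) :
    ∃ H : (Fin r → R ⧸ I) →ₗ[R] (R ⧸ I), H ∘ₗ i = h := by
  obtain ⟨_, _⟩ := isFiniteLength_iff_isNoetherian_isArtinian.mp hI
  let N := LinearMap.range i
  have hfl : ∀ (M : Type u) [AddCommGroup M] [Module R M] [IsNoetherian R M] [IsArtinian R M],
    Module.length R (M →ₗ[R] (R ⧸ I)) ≤ Module.length R M := fun M _ _ _ _ =>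
      aux_length_hom_le hS M (isFiniteLength_iff_isNoetherian_isArtinian.mpr ⟨‹_›, ‹_›⟩)
  have h1 : Module.length R (Fin r → R ⧸ I) ≤ Module.length R ((Fin r → R ⧸ I) →ₗ[R] (R ⧸ I)) := by
    let e : (Fin r → R ⧸ I) →ₗ[R] ((Fin r → R ⧸ I) →ₗ[R] (R ⧸ I)) :=
      LinearMap.mk₂ R (fun v u => ∑ j, v j * u j)
        (by intros; simp [add_mul, Finset.sum_add_distrib])
        (by intros; simp [Finset.smul_sum])
        (by intros; simp [mul_add, Finset.sum_add_distrib])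
        (by intros; simp [Finset.smul_sum])
    apply Module.length_le_of_injective e
    intro v v' hv
    funext j
    have := LinearMap.congr_fun hv (Pi.single j 1)
    simpa [e, Pi.single_apply] using this
  have h2 := aux_length_hom_add (A := R ⧸ I) (Fin r → R ⧸ I) N
  have h3 := Module.length_eq_add_of_exact N.subtype N.mkQ N.subtype_injective
      N.mkQ_surjective (LinearMap.exact_subtype_mkQ N)
  have h4 := hfl ((Fin r → R ⧸ I) ⧸ N)
  have h5 := hfl N
  set im := LinearMap.range (LinearMap.lcomp R (R ⧸ I) N.subtype) with him
  have hf1 : Module.length R ((Fin r → R ⧸ I) ⧸ N) ≠ ⊤ := Module.length_ne_top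
  have hf2 : Module.length R N ≠ ⊤ := Module.length_ne_top
  have h6 : Module.length R N ≤ Module.length R im := by
    have : Module.length R N + Module.length R ((Fin r → R ⧸ I) ⧸ N) ≤ 
      Module.length R im + Module.length R ((Fin r → R ⧸ I) ⧸ N) := by
      rw [← h3]
      refine h1.trans ?_
      rw [h2, add_comm]
      gcongr
    exact (ENat.add_le_add_iff_right hf1).mp this
  have hfl2 : IsFiniteLength R (N →ₗ[R] (R ⧸ I)) := by
    rw [← Module.length_ne_top_iff]
    exact ne_top_of_le_ne_top hf2 h5
  obtain ⟨_, _⟩ := isFiniteLength_iff_isNoetherian_isArtinian.mp hfl2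
  have htop : im = ⊤ := by
    by_contra hne
    have := Submodule.length_lt hne
    exact absurd (h5.trans h6) (not_le.mpr this)
  let g : N →ₗ[R] (R ⧸ I) := (Submodule.liftQ _ h hih) ∘ₗ i.quotKerEquivRange.symm.toLinearMap
  have hg : g ∈ im := htop ▸ Submodule.mem_top
  obtain ⟨H, hH⟩ := hg
  refine ⟨H, ?_⟩
  ext k
  have h7 : H (i k) = g ⟨i k, k, rfl⟩ := LinearMap.congr_fun hH ⟨i k, k, rfl⟩
  rw [LinearMap.comp_apply, h7]
  have h8 : i.quotKerEquivRange.symm ⟨i k, k, rfl⟩ = Submodule.Quotient.mk k := by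
    rw [LinearEquiv.symm_apply_eq]
    rfl
  simp only [g, LinearMap.comp_apply, LinearEquiv.coe_coe, h8]
  rfl

/-- Consequences of the Gorenstein hypothesis for the quotient by a regular element. -/
theorem aux_gor_socle [IsLocalRing R] (hdim : ringKrullDim R = 1) [IsNoetherianRing R]
    (hGor : IsGorensteinLocalRing R) {w : R} (hwm : w ∈ maximalIdeal R)
    (hw : w ∈ nonZeroDivisors R) :
    ∃ Z : Submodule R (R ⧸ Ideal.span {w}), Module.length R Z = 1 ∧
      ∀ a : R ⧸ Ideal.span {w}, (∀ r ∈ maximalIdeal R, r • a = 0) ↔ a ∈ Z := by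
  have hreg : IsSMulRegular R w := by
    intro a b hab
    exact (mul_cancel_left_mem_nonZeroDivisors hw).mp hab
  have h := hGor.2 [w] (by simpa using hwm) (aux_isRegular_singleton hwm hreg) (by simp [hdim])
  rw [Ideal.ofList_singleton] at h
  set I := Ideal.span {w} with hI
  set C : Ideal R := I.colon (maximalIdeal R) with hC
  let g : C →ₗ[R] (R ⧸ I) := (Submodule.mkQ I) ∘ₗ C.subtype
  have hker : LinearMap.ker g = Submodule.comap C.subtype I := by
    rw [LinearMap.ker_comp, Submodule.ker_mkQ]
  refine ⟨LinearMap.range g, ?_, ?_⟩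
  · have e1 := LinearEquiv.length_eq g.quotKerEquivRange
    have e2 := LinearEquiv.length_eq (Submodule.quotEquivOfEq _ _ hker)
    rw [← e1, e2]
    have h3 := Module.coe_length R (C ⧸ Submodule.comap C.subtype I)
    have h4 : ((Module.length R (C ⧸ Submodule.comap C.subtype I) : ℕ∞) : WithBot ℕ∞) = 1 :=
      h3.trans h
    exact_mod_cast h4
  · intro a
    obtain ⟨a, rfl⟩ := Ideal.Quotient.mk_surjective a
    have key : ∀ b : R, (∀ r ∈ maximalIdeal R, r • (Ideal.Quotient.mk I b) = 0) ↔ b ∈ C := by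
      intro b
      rw [hC, Submodule.mem_colon]
      refine forall₂_congr fun r _ => ?_
      rw [← Ideal.Quotient.eq_zero_iff_mem, smul_eq_mul, mul_comm, map_mul]
      rfl
    rw [key]
    constructor
    · intro ha
      exact ⟨⟨a, ha⟩, rfl⟩
    · rintro ⟨⟨b, hb⟩, hba⟩
      rw [← key] at hb ⊢
      have : Ideal.Quotient.mk I b = Ideal.Quotient.mk I a := hba
      rw [← this]; exact hb

theorem aux_gor_extend [IsLocalRing R] (hdim : ringKrullDim R = 1) [IsNoetherianRing R]
    (hGor : IsGorensteinLocalRing R) {w : R} (hwm : w ∈ maximalIdeal R)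
    (hw : w ∈ nonZeroDivisors R)
    (r : ℕ) {K : Type u} [AddCommGroup K] [Module R K] (i : K →ₗ[R] (Fin r → R ⧸ Ideal.span {w}))
    (h : K →ₗ[R] (R ⧸ Ideal.span {w})) (hih : LinearMap.ker i ≤ LinearMap.ker h) :
    ∃ H : (Fin r → R ⧸ Ideal.span {w}) →ₗ[R] (R ⧸ Ideal.span {w}), H ∘ₗ i = h := by
  obtain ⟨Z, hZ1, hZ2⟩ := aux_gor_socle hdim hGor hwm hw
  apply aux_extend (Ideal.span {w}) (aux_finiteLength_quot hdim hw) _ r i h hih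
  intro S _ _ _
  exact aux_hom_simple_le Z hZ1.le (fun a => (hZ2 a).mp) S

/-- Double annihilator property. -/
theorem aux_double_ann [IsLocalRing R] (hdim : ringKrullDim R = 1) [IsNoetherianRing R]
    (hGor : IsGorensteinLocalRing R) {w : R} (hwm : w ∈ maximalIdeal R)
    (hw : w ∈ nonZeroDivisors R) (J : Ideal R) (hwJ : w ∈ J) (a : R) (ha : a ∉ J) :
    ∃ b : R, (∀ j ∈ J, b * j ∈ Ideal.span {w}) ∧ b * a ∉ Ideal.span {w} := by
  obtain ⟨Z, hZ1, hZ2⟩ := aux_gor_socle hdim hGor hwm hw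
  have : Nontrivial Z := Module.length_pos_iff.mp (by rw [hZ1]; exact one_pos)
  obtain ⟨⟨s, hsZ⟩, hs0⟩ := exists_ne (0 : Z)
  have hs0' : s ≠ 0 := fun h => hs0 (Subtype.ext h)
  have hsm := (hZ2 s).mpr hsZ
  let i : (R × J) →ₗ[R] (Fin 1 → R ⧸ Ideal.span {w}) :=
    LinearMap.pi (fun _ => (Submodule.mkQ (Ideal.span {w})) ∘ₗ
      LinearMap.coprod (LinearMap.toSpanSingleton R R a) J.subtype)
  let h : (R × J) →ₗ[R] (R ⧸ Ideal.span {w}) :=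
    (LinearMap.toSpanSingleton R _ s) ∘ₗ LinearMap.fst R R J
  have hi : ∀ p : R × J, i p = fun _ => Ideal.Quotient.mk _ (p.1 * a + p.2) := by
    intro p; funext t; rfl
  have hh : ∀ p : R × J, h p = p.1 • s := by intro p; rfl
  obtain ⟨H, hH⟩ := aux_gor_extend hdim hGor hwm hw 1 i h (by
    rintro ⟨r, j⟩ hp
    rw [LinearMap.mem_ker] at hp ⊢
    rw [hi] at hp
    rw [hh]
    apply hsm
    have h1 := congrFun hp 0
    have h2 : r * a + j ∈ Ideal.span {w} := Ideal.Quotient.eq_zero_iff_mem.mp h1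
    have h3 : r * a ∈ J := by
      have h4 : r * a + j ∈ J := (Ideal.span_singleton_le_iff_mem J).mpr hwJ h2
      exact (Ideal.add_mem_iff_left J j.2).mp h4
    by_contra hr
    have hu : IsUnit r := by simpa using hr
    exact ha ((Ideal.unit_mul_mem_iff_mem J hu).mp h3))
  obtain ⟨b, hb⟩ := Ideal.Quotient.mk_surjective (H (fun _ => 1))
  have hHc : ∀ c : R, H (fun _ => Ideal.Quotient.mk _ c) = Ideal.Quotient.mk _ (b * c) := by
    intro c
    have : (fun _ => Ideal.Quotient.mk _ c : Fin 1 → R ⧸ Ideal.span {w}) = c • (fun _ => 1) := by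
      funext t
      simp [Algebra.smul_def]
    rw [this, map_smul, ← hb, mul_comm, map_mul]
    rfl
  refine ⟨b, ?_, ?_⟩
  · intro j hj
    have h1 := LinearMap.congr_fun hH (0, ⟨j, hj⟩)
    rw [LinearMap.comp_apply, hi, hh, hHc] at h1
    rw [← Ideal.Quotient.eq_zero_iff_mem]
    simpa using h1
  · intro hba
    have h1 := LinearMap.congr_fun hH (1, 0)
    rw [LinearMap.comp_apply, hi, hh, hHc] at h1
    apply hs0'
    have h2 : Ideal.Quotient.mk (Ideal.span {w}) (b * a) = s := by simpa using h1
    rw [← h2]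
    exact Ideal.Quotient.eq_zero_iff_mem.mpr hba

/-- Maps to `R/w` from a module on which `w` is regular lift to `R`. -/
theorem aux_lift [IsLocalRing R] (hdim : ringKrullDim R = 1) [IsNoetherianRing R]
    (hGor : IsGorensteinLocalRing R) {w : R} (hwm : w ∈ maximalIdeal R)
    (hw : w ∈ nonZeroDivisors R) {X : Type u} [AddCommGroup X] [Module R X] [Module.Finite R X]
    (hX : IsSMulRegular X w) (f : X →ₗ[R] (R ⧸ Ideal.span {w})) :
    ∃ g : X →ₗ[R] R, ∀ ξ, Ideal.Quotient.mk (Ideal.span {w}) (g ξ) = f ξ := by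
  obtain ⟨r, π, hπ⟩ := Module.Finite.exists_fin' R X
  let K := LinearMap.ker π
  let Φ : ((Fin r → R) →ₗ[R] R) →ₗ[R] (K →ₗ[R] R) := LinearMap.lcomp R R K.subtype
  let q : R →ₗ[R] (R ⧸ Ideal.span {w}) := Submodule.mkQ (Ideal.span {w})
  have hq : ∀ a, q a = 0 ↔ ∃ b, a = w * b := by
    intro a
    exact Ideal.Quotient.eq_zero_iff_mem.trans Ideal.mem_span_singleton
  -- division by `w`
  have hdiv : ∀ k : K →ₗ[R] R, q ∘ₗ k = 0 → ∃ k' : K →ₗ[R] R, k = w • k' := by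
    intro k hk
    have h1 : ∀ κ, ∃ b, k κ = w * b := fun κ => (hq _).mp (LinearMap.congr_fun hk κ)
    choose b hb using h1
    refine ⟨⟨⟨b, ?_⟩, ?_⟩, ?_⟩
    · intro κ κ'
      apply (mul_cancel_left_mem_nonZeroDivisors hw).mp
      rw [mul_add, ← hb, ← hb, ← hb, map_add]
    · intro c κ
      apply (mul_cancel_left_mem_nonZeroDivisors hw).mp
      simp only [RingHom.id_apply, smul_eq_mul]
      rw [← hb, map_smul, hb, smul_eq_mul]
      ring
    · ext κ
      exact hb κ
  have hlift : ∀ (G : (Fin r → R) →ₗ[R] (R ⧸ Ideal.span {w})),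
      ∃ G' : (Fin r → R) →ₗ[R] R, q ∘ₗ G' = G := fun G =>
    Module.projective_lifting_property q G (Submodule.mkQ_surjective _)
  have hΦ : LinearMap.range Φ = ⊤ := by
    apply top_le_iff.mp
    apply Submodule.le_of_le_smul_of_le_jacobson_bot (I := Ideal.span {w})
      Module.Finite.fg_top
    · refine le_trans ?_ (IsLocalRing.maximalIdeal_le_jacobson _)
      simpa [Ideal.span_le] using hwm
    · rintro h -
      let i : K →ₗ[R] (Fin r → R ⧸ Ideal.span {w}) :=
        LinearMap.pi (fun t => q ∘ₗ (LinearMap.proj t) ∘ₗ K.subtype)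
      obtain ⟨H, hH⟩ := aux_gor_extend hdim hGor hwm hw r i (q ∘ₗ h) (by
        intro κ hκ
        rw [LinearMap.mem_ker] at hκ ⊢
        have h1 : ∀ t, ∃ b, κ.1 t = w * b := fun t => (hq _).mp (congrFun hκ t)
        choose b hb using h1
        have h2 : κ.1 = w • b := funext hb
        have h3 : b ∈ K := by
          have h4 : π κ.1 = 0 := κ.2
          rw [h2, map_smul] at h4
          exact hX (by simpa using h4)
        have h5 : κ = w • (⟨b, h3⟩ : K) := Subtype.ext h2
        rw [h5, LinearMap.comp_apply, map_smul, hq]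
        exact ⟨_, rfl⟩)
      let G : (Fin r → R) →ₗ[R] (R ⧸ Ideal.span {w}) :=
        H ∘ₗ LinearMap.pi (fun t => q ∘ₗ (LinearMap.proj t))
      obtain ⟨G', hG'⟩ := hlift G
      obtain ⟨k', hk'⟩ := hdiv (h - Φ G') (by
        rw [LinearMap.comp_sub, ← hH, sub_eq_zero]
        ext κ
        exact (LinearMap.congr_fun hG' κ.1).symm)
      have h6 : h = Φ G' + w • k' := by rw [← hk']; abel
      rw [h6]
      refine Submodule.add_mem_sup ⟨G', rfl⟩ ?_
      exact Submodule.smul_mem_smul (Ideal.mem_span_singleton_self w) Submodule.mem_top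
  obtain ⟨G', hG'⟩ := hlift (f ∘ₗ π)
  obtain ⟨k', hk'⟩ := hdiv (Φ G') (by
    ext κ
    have h1 := LinearMap.congr_fun hG' κ.1
    have h2 : π κ.1 = 0 := κ.2
    rw [LinearMap.comp_apply, LinearMap.comp_apply, h2, map_zero] at h1
    exact h1)
  obtain ⟨H, hH⟩ : k' ∈ LinearMap.range Φ := hΦ ▸ Submodule.mem_top
  have hle : LinearMap.ker π ≤ LinearMap.ker (G' - w • H) := by
    intro κ hκ
    have h1 := LinearMap.congr_fun hk' ⟨κ, hκ⟩
    have h2 := LinearMap.congr_fun hH ⟨κ, hκ⟩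
    have h1' : G' κ = w * k' ⟨κ, hκ⟩ := h1
    have h2' : H κ = k' ⟨κ, hκ⟩ := h2
    simp [h1', h2']
  let g : X →ₗ[R] R := (Submodule.liftQ _ (G' - w • H) hle) ∘ₗ
    (π.quotKerEquivOfSurjective hπ).symm.toLinearMap
  have hg : ∀ v, g (π v) = G' v - w * H v := by
    intro v
    have h8 : (π.quotKerEquivOfSurjective hπ).symm (π v) = Submodule.Quotient.mk v := by
      rw [LinearEquiv.symm_apply_eq]
      rfl
    simp only [g, LinearMap.comp_apply, LinearEquiv.coe_coe, h8]
    rfl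
  refine ⟨g, fun ξ => ?_⟩
  obtain ⟨v, rfl⟩ := hπ ξ
  rw [hg]
  have h1 : q (G' v) = f (π v) := LinearMap.congr_fun hG' v
  have h2 : q (w * H v) = 0 := (hq _).mpr ⟨_, rfl⟩
  rw [← h1]
  change q (G' v - w * H v) = _
  rw [map_sub, h2, sub_zero]

theorem aux_freeRank_bdd [Nontrivial R] (X : Type v) [AddCommGroup X] [Module R X]
    [Module.Finite R X] :
    BddAbove {n : ℕ | ∃ (f : X →ₗ[R] (Fin n → R)) (g : (Fin n → R) →ₗ[R] X),
      f ∘ₗ g = LinearMap.id} := by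
  obtain ⟨r, π, hπ⟩ := Module.Finite.exists_fin' R X
  refine ⟨r, ?_⟩
  rintro n ⟨f, g, hfg⟩
  apply le_of_fin_surjective R (f ∘ₗ π)
  have hf : Function.Surjective f := fun v => ⟨g v, LinearMap.congr_fun hfg v⟩
  exact hf.comp hπ

theorem aux_freeRank_eq_zero_iff [Nontrivial R] (X : Type v) [AddCommGroup X] [Module R X]
    [Module.Finite R X] :
    freeRank R X = 0 ↔ ∀ f : X →ₗ[R] R, ¬ Function.Surjective f := by
  constructor
  · intro h f hf
    obtain ⟨e, he⟩ := hf 1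
    have h1 : 1 ≤ freeRank R X := by
      apply le_csSup (aux_freeRank_bdd X)
      refine ⟨LinearMap.pi (fun _ => f), (LinearMap.toSpanSingleton R X e) ∘ₗ LinearMap.proj 0, ?_⟩
      apply LinearMap.ext
      intro v
      funext t
      rw [Subsingleton.elim t 0]
      simp [he]
    omega
  · intro h
    apply Nat.le_zero.mp
    apply csSup_le'
    rintro n ⟨f, g, hfg⟩
    by_contra hn
    have hn' : 0 < n := by omega
    apply h (LinearMap.proj ⟨0, hn'⟩ ∘ₗ f)
    intro c
    refine ⟨g (fun _ => c), ?_⟩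
    have := LinearMap.congr_fun hfg (fun _ => c)
    exact congrFun this ⟨0, hn'⟩

theorem aux_freeRank_self_le [Nontrivial R] : freeRank R R ≤ 1 := by
  apply csSup_le'
  rintro n ⟨f, g, hfg⟩
  have hf : Function.Surjective f := fun v => ⟨g v, LinearMap.congr_fun hfg v⟩
  apply le_of_fin_surjective R (f ∘ₗ (LinearMap.proj 0 : (Fin 1 → R) →ₗ[R] R))
  exact hf.comp (fun c => ⟨fun _ => c, rfl⟩)

/-- Minimal generating sets of an ideal in a noetherian local ring. -/
theorem aux_min_gens [IsLocalRing R] [IsNoetherianRing R] (N : Ideal R) :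
    ∃ s : Finset R, Ideal.span (s : Set R) = N ∧
      ∀ f : R → R, ∑ c ∈ s, f c * c = 0 → ∀ c ∈ s, f c ∈ maximalIdeal R := by
  classical
  have hex : ∃ n : ℕ, ∃ s : Finset R, Ideal.span (s : Set R) = N ∧ s.card = n := by
    obtain ⟨s, hs⟩ := IsNoetherian.noetherian N
    exact ⟨_, s, hs, rfl⟩
  obtain ⟨s, hs, hcard⟩ := Nat.find_spec hex
  refine ⟨s, hs, ?_⟩
  intro f hf c hc
  by_contra hfc
  have hu : IsUnit (f c) := by simpa using hfc
  obtain ⟨v, hv⟩ := hu.exists_right_inv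
  have hlt : (s.erase c).card < Nat.find hex := by
    rw [← hcard]; exact Finset.card_erase_lt_of_mem hc
  apply Nat.find_min hex hlt
  refine ⟨s.erase c, ?_, rfl⟩
  apply le_antisymm
  · rw [← hs]
    exact Ideal.span_mono (by exact_mod_cast Finset.erase_subset c s)
  · rw [← hs, Ideal.span_le]
    intro d hd
    by_cases hdc : d = c
    · subst hdc
      rw [← Finset.add_sum_erase s _ hd] at hf
      have h1 : d = -v * ∑ x ∈ s.erase d, f x * x := by
        linear_combination (-d) * hv + v * hf
      have h2 : -v * ∑ x ∈ s.erase d, f x * x ∈ Ideal.span ((s.erase d : Finset R) : Set R) := by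
        apply Ideal.mul_mem_left
        apply Ideal.sum_mem
        intro e he
        exact Ideal.mul_mem_left _ _ (Ideal.subset_span (by exact_mod_cast he))
      exact (congrArg (· ∈ Ideal.span ((s.erase d : Finset R) : Set R)) h1).mpr h2
    · exact Ideal.subset_span (by simpa [hdc] using hd)

/-- Existence of a maximal Cohen-Macaulay module without free summand mapping onto `R/I`. -/
theorem aux_construct [IsLocalRing R] (hdim : ringKrullDim R = 1) [IsNoetherianRing R]
    (hGor : IsGorensteinLocalRing R) {y : R} (hym : y ∈ maximalIdeal R)
    (hy : y ∈ nonZeroDivisors R) (I : Ideal R) (hyI : y ∈ I) (hI : I ≠ ⊤)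
    (hyN : y ∉ maximalIdeal R * (Ideal.span {y}).colon I) :
    ∃ X : ModuleCat.{u} R, Module.Finite R X ∧ IsMCM R X ∧
      (∃ φ : X →ₗ[R] (R ⧸ I), Function.Surjective φ) ∧ freeRank R X = 0 := by
  classical
  set N : Ideal R := (Ideal.span {y}).colon I with hN
  have hNmem : ∀ c, c ∈ N ↔ ∀ j ∈ I, c * j ∈ Ideal.span {y} := fun c => Submodule.mem_colon
  have hyinN : y ∈ N := (hNmem y).mpr fun j _ =>
    Ideal.mul_mem_right _ _ (Ideal.mem_span_singleton_self y)
  have hdouble : ∀ t, (∀ c ∈ N, t * c ∈ Ideal.span {y}) → t ∈ I := by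
    intro t ht
    by_contra htI
    obtain ⟨b, hb1, hb2⟩ := aux_double_ann hdim hGor hym hy I hyI t htI
    exact hb2 (mul_comm b t ▸ ht b ((hNmem b).mpr hb1))
  obtain ⟨s, hs, hmin⟩ := aux_min_gens N
  let L : Submodule R (s → R) :=
    { carrier := {v | ∃ i ∈ I, ∀ c : s, y * v c = c * i}
      add_mem' := by
        rintro v v' ⟨i, hi, h⟩ ⟨i', hi', h'⟩
        refine ⟨i + i', I.add_mem hi hi', fun c => ?_⟩
        rw [Pi.add_apply, mul_add, h, h']; ring
      zero_mem' := ⟨0, I.zero_mem, fun c => by simp⟩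
      smul_mem' := by
        rintro r v ⟨i, hi, h⟩
        refine ⟨r * i, I.mul_mem_left _ hi, fun c => ?_⟩
        rw [Pi.smul_apply, smul_eq_mul]
        linear_combination r * h c }
  -- write `y` in terms of the generators
  obtain ⟨u, hu⟩ : ∃ u : s → R, ∑ c : s, u c * (c : R) = y := by
    have h1 : y ∈ Ideal.span (s : Set R) := hs ▸ hyinN
    have h2 := Submodule.mem_span_finset.mp h1
    obtain ⟨u, -, hu⟩ := h2
    refine ⟨fun c => u c, ?_⟩
    rw [← hu, ← Finset.sum_coe_sort s]
    rfl
  have hcN : ∀ c : s, (c : R) ∈ N := fun c => hs ▸ Ideal.subset_span c.2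
  obtain ⟨c₀, hc₀⟩ : ∃ c₀ : s, IsUnit (u c₀) := by
    by_contra hno
    push Not at hno
    apply hyN
    rw [← hu]
    apply Ideal.sum_mem
    intro c _
    exact Ideal.mul_mem_mul (by simpa using hno c) (hcN c)
  let φ₀ : (s → R) →ₗ[R] R := ∑ c : s, u c • LinearMap.proj c
  have hφ₀ : ∀ v, φ₀ v = ∑ c : s, u c * v c := by intro v; simp [φ₀]
  have hLφ : ∀ v ∈ L, φ₀ v ∈ I := by
    rintro v ⟨i, hi, h⟩
    have h1 : y * φ₀ v = y * i := by
      rw [hφ₀]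
      conv_rhs => rw [← hu]
      rw [Finset.sum_mul, Finset.mul_sum]
      refine Finset.sum_congr rfl fun c _ => ?_
      linear_combination u c * h c
    rw [(mul_cancel_left_mem_nonZeroDivisors hy).mp h1]
    exact hi
  let φ : ((s → R) ⧸ L) →ₗ[R] (R ⧸ I) := Submodule.mapQ L I φ₀ hLφ
  have hφ : Function.Surjective φ := by
    intro z
    obtain ⟨z, rfl⟩ := Ideal.Quotient.mk_surjective z
    obtain ⟨v, hv⟩ := hc₀.exists_right_inv
    refine ⟨Submodule.Quotient.mk (Pi.single c₀ (v * z)), ?_⟩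
    have h1 : φ₀ (Pi.single c₀ (v * z)) = z := by
      rw [hφ₀, Finset.sum_eq_single c₀]
      · rw [Pi.single_eq_same, ← mul_assoc, hv, one_mul]
      · intro c _ hc
        rw [Pi.single_eq_of_ne hc, mul_zero]
      · simp
    change Submodule.Quotient.mk (φ₀ (Pi.single c₀ (v * z))) = _
    rw [h1]; rfl
  have hnt : Nontrivial (R ⧸ I) := Ideal.Quotient.nontrivial_iff.mpr hI
  have hntX : Nontrivial ((s → R) ⧸ L) := hφ.nontrivial
  have hreg : IsSMulRegular ((s → R) ⧸ L) y := by
    rw [isSMulRegular_iff_right_eq_zero_of_smul]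
    intro ξ hξ
    obtain ⟨v, rfl⟩ := Submodule.Quotient.mk_surjective L ξ
    rw [← Submodule.Quotient.mk_smul, Submodule.Quotient.mk_eq_zero] at hξ
    rw [Submodule.Quotient.mk_eq_zero]
    have hξ' := hξ
    obtain ⟨i, hi, h⟩ := hξ
    -- `i = y * t`
    have hi' : i = y * φ₀ v := by
      apply (mul_cancel_left_mem_nonZeroDivisors hy).mp
      rw [hφ₀]
      conv_lhs => rw [← hu]
      rw [Finset.sum_mul, Finset.mul_sum, Finset.mul_sum]
      refine Finset.sum_congr rfl fun c _ => ?_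
      have := h c
      rw [Pi.smul_apply, smul_eq_mul] at this
      linear_combination (-u c) * this
    have ht : ∀ c : s, y * v c = c * φ₀ v := by
      intro c
      apply (mul_cancel_left_mem_nonZeroDivisors hy).mp
      have := h c
      rw [Pi.smul_apply, smul_eq_mul, hi'] at this
      linear_combination this
    refine ⟨φ₀ v, ?_, ht⟩
    apply hdouble
    have hle : N ≤ (Ideal.span {y}).colon {φ₀ v} := by
      rw [← hs, Ideal.span_le]
      intro c hc
      rw [SetLike.mem_coe, Submodule.mem_colon_singleton, smul_eq_mul, ← ht ⟨c, hc⟩]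
      exact Ideal.mul_mem_right _ _ (Ideal.mem_span_singleton_self y)
    intro c hc
    have := hle hc
    rw [Submodule.mem_colon_singleton, smul_eq_mul] at this
    rwa [mul_comm]
  refine ⟨ModuleCat.of R ((s → R) ⧸ L), inferInstanceAs (Module.Finite R ((s → R) ⧸ L)),
    ?_, ⟨φ, hφ⟩, ?_⟩
  · refine ⟨[y], by simpa using hym, ?_, by simp [hdim]⟩
    exact aux_isRegular_singleton (M := (s → R) ⧸ L) hym hreg
  · apply (aux_freeRank_eq_zero_iff ((s → R) ⧸ L)).mpr
    intro f hf
    let F : R → R := fun c => if hc : c ∈ s then f (Submodule.Quotient.mk (Pi.single ⟨c, hc⟩ 1)) else 0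
    have hF : ∀ v : s → R, f (Submodule.Quotient.mk v) = ∑ c : s, F c * v c := by
      intro v
      have := LinearMap.pi_apply_eq_sum_univ (f ∘ₗ L.mkQ) v
      rw [LinearMap.comp_apply] at this
      rw [show (Submodule.Quotient.mk v : (s → R) ⧸ L) = L.mkQ v from rfl, this]
      refine Finset.sum_congr rfl fun c _ => ?_
      have h1 : F c = f (Submodule.Quotient.mk (Pi.single c 1)) := by simp [F]
      rw [h1, smul_eq_mul, mul_comm]
      congr 1
      rw [LinearMap.comp_apply]
      congr 1
      change L.mkQ _ = L.mkQ _
      congr 1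
      funext j
      simp [Pi.single_apply, eq_comm]
    have h0 : ∑ c ∈ s, F c * c = 0 := by
      have h1 : (fun c : s => (c : R)) ∈ L := ⟨y, hyI, fun c => mul_comm _ _⟩
      have h2 := hF (fun c : s => (c : R))
      rw [(Submodule.Quotient.mk_eq_zero L).mpr h1, map_zero] at h2
      rw [h2, ← Finset.sum_coe_sort s]
    have hFm := hmin F h0
    obtain ⟨ξ, hξ⟩ := hf 1
    obtain ⟨v, rfl⟩ := Submodule.Quotient.mk_surjective L ξ
    have h3 : (1 : R) ∈ maximalIdeal R := by
      rw [← hξ, hF]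
      apply Ideal.sum_mem
      intro c _
      exact Ideal.mul_mem_right _ _ (hFm c c.2)
    exact (Ideal.ne_top_iff_one _).mp (IsLocalRing.maximalIdeal.isMaximal R).ne_top h3

/-- If `y ∈ m(y : I)` then every MCM module mapping onto `R/I` has a free summand. -/
theorem aux_free_summand [IsLocalRing R] (hdim : ringKrullDim R = 1) [IsNoetherianRing R]
    (hGor : IsGorensteinLocalRing R) {y : R} (hym : y ∈ maximalIdeal R)
    (hy : y ∈ nonZeroDivisors R) (I : Ideal R)
    (hyN : y ∈ maximalIdeal R * (Ideal.span {y}).colon I)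
    (X : Type u) [AddCommGroup X] [Module R X] [Module.Finite R X] (hX : IsMCM R X)
    (φ : X →ₗ[R] (R ⧸ I)) (hφ : Function.Surjective φ) : freeRank R X ≠ 0 := by
  intro hfr
  rw [aux_freeRank_eq_zero_iff] at hfr
  -- `y` is regular on `X`
  have hreg : IsSMulRegular X y := by
    obtain ⟨rs, hrs, hr, hlen⟩ := hX
    rw [hdim] at hlen
    have hlen' : rs.length = 1 := by exact_mod_cast hlen
    obtain ⟨z, rfl⟩ := List.length_eq_one_iff.mp hlen'
    have hz : IsSMulRegular X z :=
      (RingTheory.Sequence.isWeaklyRegular_singleton_iff X z).mp hr.toIsWeaklyRegular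
    obtain ⟨k, hk⟩ := aux_pow_mem hdim hy (hrs z (by simp))
    obtain ⟨c, hc⟩ := Ideal.mem_span_singleton'.mp hk
    have h1 : IsSMulRegular X (c * y) := hc ▸ hz.pow k
    exact IsSMulRegular.of_mul h1
  -- for each `b ∈ (y : I)` a lift
  have hb : ∀ b ∈ (Ideal.span {y}).colon (I : Set R), ∃ g : X →ₗ[R] R, ∀ ξ a,
      φ ξ = Ideal.Quotient.mk I a → g ξ - b * a ∈ Ideal.span {y} := by
    intro b hb
    have hle : I ≤ Submodule.comap (b • LinearMap.id : R →ₗ[R] R) (Ideal.span {y}) := by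
      intro j hj
      exact Submodule.mem_colon.mp hb j hj
    obtain ⟨g, hg⟩ := aux_lift hdim hGor hym hy hreg
      ((Submodule.mapQ I (Ideal.span {y}) (b • LinearMap.id) hle) ∘ₗ φ)
    refine ⟨g, fun ξ a ha => ?_⟩
    rw [← Ideal.Quotient.mk_eq_mk_iff_sub_mem, hg, LinearMap.comp_apply, ha]
    rfl
  -- elements of `m (y : I)`
  have hgen : ∀ t ∈ maximalIdeal R * (Ideal.span {y}).colon (I : Set R), ∃ g : X →ₗ[R] R, ∀ ξ a,
      φ ξ = Ideal.Quotient.mk I a → ∃ d ∈ maximalIdeal R, g ξ = t * a + y * d := by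
    intro t ht
    induction ht using Submodule.mul_induction_on' with
    | mem_mul_mem p hp b hbN =>
      obtain ⟨g, hg⟩ := hb b hbN
      refine ⟨p • g, fun ξ a ha => ?_⟩
      obtain ⟨d, hd⟩ := Ideal.mem_span_singleton'.mp (hg ξ a ha)
      refine ⟨p * d, Ideal.mul_mem_right _ _ hp, ?_⟩
      rw [LinearMap.smul_apply, smul_eq_mul]
      linear_combination (-p) * hd
    | add t _ t' _ h h' =>
      obtain ⟨g, hg⟩ := h
      obtain ⟨g', hg'⟩ := h'
      refine ⟨g + g', fun ξ a ha => ?_⟩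
      obtain ⟨d, hd, h1⟩ := hg ξ a ha
      obtain ⟨d', hd', h1'⟩ := hg' ξ a ha
      refine ⟨d + d', Ideal.add_mem _ hd hd', ?_⟩
      rw [LinearMap.add_apply, h1, h1']
      ring
  obtain ⟨g, hg⟩ := hgen y hyN
  have h1 : ∀ ξ, ∃ e, g ξ = y * e := by
    intro ξ
    obtain ⟨a, ha⟩ := Ideal.Quotient.mk_surjective (φ ξ)
    obtain ⟨d, -, h⟩ := hg ξ a ha.symm
    exact ⟨a + d, by rw [h]; ring⟩
  choose e he using h1
  let G : X →ₗ[R] R :=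
    { toFun := e
      map_add' := by
        intro ξ ξ'
        apply (mul_cancel_left_mem_nonZeroDivisors hy).mp
        rw [mul_add, ← he, ← he, ← he, map_add]
      map_smul' := by
        intro c ξ
        apply (mul_cancel_left_mem_nonZeroDivisors hy).mp
        simp only [RingHom.id_apply, smul_eq_mul]
        rw [← he, map_smul, he, smul_eq_mul]
        ring }
  apply hfr G
  obtain ⟨ξ, hξ⟩ := hφ 1
  obtain ⟨d, hd, h⟩ := hg ξ 1 (by rw [hξ, map_one])
  have h2 : e ξ = 1 + d := by
    apply (mul_cancel_left_mem_nonZeroDivisors hy).mp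
    rw [← he, h]; ring
  have hu : IsUnit (e ξ) := by
    rw [h2]
    have := IsLocalRing.isUnit_one_sub_self_of_mem_nonunits (-d)
      ((maximalIdeal R).neg_mem hd)
    simpa using this
  obtain ⟨v, hv⟩ := hu.exists_left_inv
  intro c
  refine ⟨(c * v) • ξ, ?_⟩
  rw [map_smul, smul_eq_mul]
  change c * v * e ξ = c
  rw [mul_assoc, hv, mul_one]

end Helpers

/-- For a one-dimensional Gorenstein local ring `(R,m)`, a non zero-divisor
`x ∈ m` and `n ≥ 1`: `δ(R/mⁿ) = 1` iff `x mⁿ : m ⊆ (x)`. -/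
theorem auslanderDelta_eq_one_iff_colon_le
    (R : Type u) [CommRing R] [IsLocalRing R] [IsNoetherianRing R]
    (hdim : ringKrullDim R = 1) (hGor : IsGorensteinLocalRing R)
    (x : R) (hxm : x ∈ IsLocalRing.maximalIdeal R) (hx : x ∈ nonZeroDivisors R)
    (n : ℕ) (hn : 1 ≤ n) :
    auslanderDelta R (R ⧸ (IsLocalRing.maximalIdeal R ^ n)) = 1 ↔
      (Ideal.span {x} * IsLocalRing.maximalIdeal R ^ n).colon (IsLocalRing.maximalIdeal R) ≤
        Ideal.span {x} := by
  classical
  set m := IsLocalRing.maximalIdeal R with hm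
  set I := m ^ n with hI
  have hIm : I ≤ m := Ideal.pow_le_self (by omega)
  have hyI : x ^ n ∈ I := Ideal.pow_mem_pow hxm n
  have hym : x ^ n ∈ m := hIm hyI
  have hy : x ^ n ∈ nonZeroDivisors R := pow_mem hx n
  have hItop : I ≠ ⊤ := fun h => (IsLocalRing.maximalIdeal.isMaximal R).ne_top
    (top_le_iff.mp (h ▸ hIm))
  set y := x ^ n with hydef
  have hNmem : ∀ c, c ∈ (Ideal.span {y}).colon (I : Set R) ↔
    ∀ j ∈ I, c * j ∈ Ideal.span {y} := fun c => Submodule.mem_colon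
  have hyinN : y ∈ (Ideal.span {y}).colon (I : Set R) := (hNmem y).mpr fun j _ =>
    Ideal.mul_mem_right _ _ (Ideal.mem_span_singleton_self y)
  -- first: δ = 1 iff `y ∈ m (y : I)`
  have key1 : auslanderDelta R (R ⧸ I) = 1 ↔ y ∈ m * (Ideal.span {y}).colon (I : Set R) := by
    have hle : auslanderDelta R (R ⧸ I) ≤ 1 := by
      refine le_trans (Nat.sInf_le ⟨ModuleCat.of R R, inferInstanceAs (Module.Finite R R), ?_,
        ⟨Submodule.mkQ I, Submodule.mkQ_surjective I⟩, rfl⟩) (aux_freeRank_self_le (R := R))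
      exact hGor.1
    constructor
    · intro h1
      by_contra hyN
      obtain ⟨X, hX1, hX2, hX3, hX4⟩ := aux_construct hdim hGor hym hy I hyI hItop hyN
      have : auslanderDelta R (R ⧸ I) ≤ 0 := Nat.sInf_le ⟨X, hX1, hX2, hX3, hX4⟩
      omega
    · intro hyN
      by_contra hne
      have h0 : auslanderDelta R (R ⧸ I) = 0 := by omega
      rcases Nat.sInf_eq_zero.mp h0 with h | h
      · obtain ⟨X, hX1, hX2, ⟨φ, hφ⟩, hX4⟩ := h
        exact aux_free_summand hdim hGor hym hy I hyN X hX2 φ hφ hX4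
      · have : freeRank R R ∈ (∅ : Set ℕ) := by
          rw [← h]
          exact ⟨ModuleCat.of R R, inferInstanceAs (Module.Finite R R), hGor.1,
            ⟨Submodule.mkQ I, Submodule.mkQ_surjective I⟩, rfl⟩
        exact this
  rw [key1]
  have hcol : ∀ a, a ∈ (Ideal.span {x} * I).colon (m : Set R) ↔
      ∀ u ∈ m, a * u ∈ Ideal.span {x} * I := fun a => Submodule.mem_colon
  constructor
  · intro hyN a ha
    rw [hcol] at ha
    -- `a * t ∈ (x y)` for `t ∈ m (y : I)`
    have h1 : ∀ t ∈ m * (Ideal.span {y}).colon (I : Set R), a * t ∈ Ideal.span {x * y} := by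
      intro t ht
      induction ht using Submodule.mul_induction_on' with
      | mem_mul_mem u hu b hb =>
        obtain ⟨j, hj, hju⟩ := Ideal.mem_span_singleton_mul.mp (ha u hu)
        obtain ⟨c, hc⟩ := Ideal.mem_span_singleton'.mp ((hNmem b).mp hb j hj)
        rw [Ideal.mem_span_singleton']
        exact ⟨c, by linear_combination x * hc + b * hju⟩
      | add t _ t' _ h h' =>
        rw [mul_add]; exact Ideal.add_mem _ h h'
    obtain ⟨c, hc⟩ := Ideal.mem_span_singleton'.mp (h1 y hyN)
    rw [Ideal.mem_span_singleton']
    refine ⟨c, (mul_cancel_left_mem_nonZeroDivisors hy).mp ?_⟩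
    linear_combination hc
  · intro hle
    by_contra hyN
    have hxy : x * y ∈ nonZeroDivisors R := mul_mem hx hy
    obtain ⟨a, ha1, ha2⟩ := aux_double_ann hdim hGor (w := x * y) (Ideal.mul_mem_right _ _ hxm) hxy
      (m * (Ideal.span {y}).colon (I : Set R)) (Ideal.mul_mem_mul hxm hyinN) y hyN
    have ha : a ∉ Ideal.span {x} := by
      intro h
      obtain ⟨c, hc⟩ := Ideal.mem_span_singleton'.mp h
      exact ha2 (Ideal.mem_span_singleton'.mpr ⟨c, by rw [← hc]; ring⟩)
    apply ha
    apply hle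
    rw [hcol]
    intro u hu
    -- `a u = x v`
    obtain ⟨v, hv⟩ := Ideal.mem_span_singleton'.mp (ha1 (u * y) (Ideal.mul_mem_mul hu hyinN))
    have hv' : x * v = a * u := by
      apply (mul_cancel_left_mem_nonZeroDivisors hy).mp
      linear_combination hv
    rw [← hv']
    apply Ideal.mul_mem_mul (Ideal.mem_span_singleton_self x)
    by_contra hvI
    obtain ⟨b, hb1, hb2⟩ := aux_double_ann hdim hGor hym hy I hyI v hvI
    apply hb2
    obtain ⟨d, hd⟩ := Ideal.mem_span_singleton'.mp
      (ha1 (u * b) (Ideal.mul_mem_mul hu ((hNmem b).mpr hb1)))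
    rw [Ideal.mem_span_singleton']
    refine ⟨d, (mul_cancel_left_mem_nonZeroDivisors hx).mp ?_⟩
    linear_combination hd - b * hv'
end

section
/- Let k be a field and f = z^{10} − 2 z^8 y + z^6 y^2 − y^9 ∈ k[y,z]. Then f is irreducible in k[y,z]. -/
open MvPolynomial

/-- The grading map `y ↦ y T¹⁰`, `z ↦ z T⁹`. -/
noncomputable def phi (k : Type*) [Field k] :
    MvPolynomial (Fin 2) k →ₐ[k] Polynomial (MvPolynomial (Fin 2) k) :=
  aeval ![Polynomial.C (X 0) * Polynomial.X ^ 10, Polynomial.C (X 1) * Polynomial.X ^ 9]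

lemma phi_one (k : Type*) [Field k] (g : MvPolynomial (Fin 2) k) :
    (phi k g).eval 1 = g := by
  have : (((Polynomial.evalRingHom (1 : MvPolynomial (Fin 2) k))).comp (phi k).toRingHom)
      = RingHom.id _ := by
    apply MvPolynomial.ringHom_ext
    · intro r; simp [phi, MvPolynomial.algebraMap_eq]
    · intro i; fin_cases i <;> simp [phi]
  simpa using congrArg (fun h => h g) this

lemma phi_zero (k : Type*) [Field k] (g : MvPolynomial (Fin 2) k) :
    (phi k g).eval 0 = C (constantCoeff g) := by
  have : (((Polynomial.evalRingHom (0 : MvPolynomial (Fin 2) k))).comp (phi k).toRingHom)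
      = (C : k →+* MvPolynomial (Fin 2) k).comp constantCoeff := by
    apply MvPolynomial.ringHom_ext
    · intro r; simp [phi, MvPolynomial.algebraMap_eq]
    · intro i; fin_cases i <;> simp [phi]
  simpa using congrArg (fun h => h g) this

lemma phi_y (k : Type*) [Field k] (g : MvPolynomial (Fin 2) k) :
    (phi k g).map (eval ![(1 : k), 0]) =
      Polynomial.expand k 10 (aeval ![(Polynomial.X : Polynomial k), 0] g) := by
  have : (Polynomial.mapRingHom (eval ![(1 : k), 0])).comp (phi k).toRingHom
      = (Polynomial.expand k 10).toRingHom.comp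
        (aeval ![(Polynomial.X : Polynomial k), 0]).toRingHom := by
    apply MvPolynomial.ringHom_ext
    · intro r; simp [phi, MvPolynomial.algebraMap_eq]
    · intro i; fin_cases i <;> simp [phi]
  simpa using congrArg (fun h => h g) this

lemma phi_z (k : Type*) [Field k] (g : MvPolynomial (Fin 2) k) :
    (phi k g).map (eval ![(0 : k), 1]) =
      Polynomial.expand k 9 (aeval ![0, (Polynomial.X : Polynomial k)] g) := by
  have : (Polynomial.mapRingHom (eval ![(0 : k), 1])).comp (phi k).toRingHom
      = (Polynomial.expand k 9).toRingHom.comp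
        (aeval ![0, (Polynomial.X : Polynomial k)]).toRingHom := by
    apply MvPolynomial.ringHom_ext
    · intro r; simp [phi, MvPolynomial.algebraMap_eq]
    · intro i; fin_cases i <;> simp [phi]
  simpa using congrArg (fun h => h g) this

lemma isUnit_of_phi (k : Type*) [Field k] (g : MvPolynomial (Fin 2) k) (hg : g ≠ 0)
    (h : (phi k g).natDegree = 0) : IsUnit g := by
  have h1 := phi_one k g
  have h0 := phi_zero k g
  rw [Polynomial.eq_C_of_natDegree_eq_zero h, Polynomial.eval_C] at h1 h0
  rw [h1] at h0
  rw [h0] at hg ⊢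
  refine IsUnit.map C (isUnit_iff_ne_zero.mpr ?_)
  intro h; exact hg (by rw [h, C_0])

lemma dvd_of_lc (k : Type*) [Field k] (g : MvPolynomial (Fin 2) k)
    (hy : eval ![(1 : k), 0] (phi k g).leadingCoeff ≠ 0)
    (hz : eval ![(0 : k), 1] (phi k g).leadingCoeff ≠ 0) : 90 ∣ (phi k g).natDegree := by
  have e1 := Polynomial.natDegree_map_of_leadingCoeff_ne_zero _ hy
  have e2 := Polynomial.natDegree_map_of_leadingCoeff_ne_zero _ hz
  rw [phi_y, Polynomial.natDegree_expand] at e1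
  rw [phi_z, Polynomial.natDegree_expand] at e2
  omega

/-- For any field `k`, the polynomial
`f = z¹⁰ − 2z⁸y + z⁶y² − y⁹` is irreducible in `k[y,z]`
(here `y = X 0` and `z = X 1`). -/
theorem irreducible_poly (k : Type*) [Field k] :
    Irreducible ((X 1) ^ 10 - 2 * (X 1) ^ 8 * (X 0) + (X 1) ^ 6 * (X 0) ^ 2 - (X 0) ^ 9 :
      MvPolynomial (Fin 2) k) := by
  set f : MvPolynomial (Fin 2) k :=
    (X 1) ^ 10 - 2 * (X 1) ^ 8 * (X 0) + (X 1) ^ 6 * (X 0) ^ 2 - (X 0) ^ 9 with hf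
  have hphi : phi k f = Polynomial.C (X 1 ^ 10 - X 0 ^ 9) * Polynomial.X ^ 90
      + (Polynomial.C (-2 * X 1 ^ 8 * X 0) * Polynomial.X ^ 82
      + Polynomial.C (X 1 ^ 6 * X 0 ^ 2) * Polynomial.X ^ 74) := by
    simp only [hf, phi, map_sub, map_add, map_mul, map_pow, map_neg, aeval_X, map_ofNat,
      Matrix.cons_val_zero, Matrix.cons_val_one]
    ring
  have hne : (X 1 ^ 10 - X 0 ^ 9 : MvPolynomial (Fin 2) k) ≠ 0 := by
    intro h
    simpa using congrArg (eval ![(0 : k), 1]) h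
  have hdeg : (phi k f).natDegree = 90 := by
    rw [hphi]
    compute_degree
    · simpa using hne
    all_goals norm_num
  have hlc : (phi k f).leadingCoeff = X 1 ^ 10 - X 0 ^ 9 := by
    rw [Polynomial.leadingCoeff, hdeg, hphi]
    simp only [Polynomial.coeff_add, Polynomial.coeff_C_mul, Polynomial.coeff_X_pow]
    norm_num
  have hf0 : f ≠ 0 := by
    intro h; rw [h] at hdeg; simp at hdeg
  constructor
  · intro hu
    have h2 := hu.map constantCoeff
    simp [hf] at h2
  · intro a b hab
    have ha : a ≠ 0 := by rintro rfl; simp [hab] at hf0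
    have hb : b ≠ 0 := by rintro rfl; simp [hab] at hf0
    have hpa : phi k a ≠ 0 := by
      intro h; apply ha; rw [← phi_one k a, h]; simp
    have hpb : phi k b ≠ 0 := by
      intro h; apply hb; rw [← phi_one k b, h]; simp
    rw [hab, map_mul] at hdeg hlc
    rw [Polynomial.natDegree_mul hpa hpb] at hdeg
    rw [Polynomial.leadingCoeff_mul] at hlc
    have hy := congrArg (eval ![(1 : k), 0]) hlc
    have hz := congrArg (eval ![(0 : k), 1]) hlc
    rw [map_mul] at hy hz
    have hd : 90 ∣ (phi k a).natDegree := by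
      apply dvd_of_lc
      · intro h; rw [h] at hy; simp at hy
      · intro h; rw [h] at hz; simp at hz
    have : (phi k a).natDegree = 0 ∨ (phi k b).natDegree = 0 := by omega
    exact this.imp (isUnit_of_phi k a ha) (isUnit_of_phi k b hb)
end

section
/- Let k be a field, R = (k[x,y,z]/(x^2 − y^5, x y^2 + y z^3 − z^5)) localized at (x,y,z), with maximal ideal m = (x,y,z). Then m^6 ⊆ yR, i.e., the Löwy length of R/yR is at most 6; consequently gℓℓ(R) ≤ 6. -/
open IsLocalRing

universe u v

open MvPolynomial

lemma pow_aux {R : Type*} [CommRing R] (a b c : R) (ha : a ^ 2 ∈ Ideal.span {b}) (n : ℕ) :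
    (Ideal.span {a, b, c}) ^ (n + 1) ≤ Ideal.span {b, c ^ n * a, c ^ (n + 1)} := by
  induction n with
  | zero =>
    rw [zero_add, pow_one, pow_zero, one_mul, pow_one, Set.insert_comm]
  | succ n ih =>
    rw [pow_succ]
    refine (Ideal.mul_mono_left ih).trans ?_
    rw [Ideal.span_mul_span', Ideal.span_le]
    set K := Ideal.span {b, c ^ (n + 1) * a, c ^ (n + 1 + 1)} with hK
    have h1 : b ∈ K := Ideal.subset_span (by simp)
    have h2 : c ^ (n + 1) * a ∈ K := Ideal.subset_span (by simp)
    have h3 : c ^ (n + 1 + 1) ∈ K := Ideal.subset_span (by simp)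
    have h4 : a ^ 2 ∈ K := (Ideal.span_singleton_le_iff_mem K).2 h1 ha
    rintro _ ⟨u, (rfl | rfl | rfl), v, (rfl | rfl | rfl), rfl⟩
    · exact K.mul_mem_right _ h1
    · exact K.mul_mem_right _ h1
    · exact K.mul_mem_right _ h1
    · have := K.mul_mem_left (c ^ n) h4
      rwa [pow_two, ← mul_assoc] at this
    · exact K.mul_mem_left _ h1
    · rw [pow_succ, mul_right_comm] at h2
      exact h2
    · exact h2
    · exact K.mul_mem_left _ h1
    · rw [pow_succ] at h3
      exact h3

lemma pow_six_aux {R : Type*} [CommRing R] (a b c : R) (ha : a ^ 2 ∈ Ideal.span {b})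
    (hc : c ^ 5 ∈ Ideal.span {b}) :
    (Ideal.span {a, b, c}) ^ 6 ≤ Ideal.span {b} := by
  refine (pow_aux a b c ha 5).trans ?_
  rw [Ideal.span_le]
  rintro _ (rfl | rfl | rfl)
  · exact Ideal.mem_span_singleton_self _
  · exact Ideal.mul_mem_right _ _ hc
  · exact Ideal.pow_mem_of_pow_mem _ hc (by norm_num)

section
variable (k : Type*) [Field k]

lemma ker_eq : RingHom.ker (aeval (R := k) (![0,0,0] : Fin 3 → MvPolynomial (Fin 3) k)) =
    (Ideal.span {X 0, X 1, X 2} : Ideal (MvPolynomial (Fin 3) k)) := by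
  set P := (Ideal.span {X 0, X 1, X 2} : Ideal (MvPolynomial (Fin 3) k)) with hP
  apply le_antisymm
  · intro f hf
    have key : ∀ f, f - aeval (R := k) (![0,0,0] : Fin 3 → MvPolynomial (Fin 3) k) f ∈ P := by
      intro f
      have : (Ideal.Quotient.mkₐ k P) =
        (Ideal.Quotient.mkₐ k P).comp (aeval (R := k) (![0,0,0] : Fin 3 → MvPolynomial (Fin 3) k)) := by
        ext i
        have : (X i : MvPolynomial (Fin 3) k) ∈ P := Ideal.subset_span (by fin_cases i <;> simp)
        simp only [AlgHom.comp_apply, aeval_X, Ideal.Quotient.mkₐ_eq_mk]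
        rw [Ideal.Quotient.eq_zero_iff_mem.2 this]
        fin_cases i <;> simp
      rw [← Ideal.Quotient.eq]
      exact DFunLike.congr_fun this f
    have := key f
    rwa [(RingHom.mem_ker).1 hf, sub_zero] at this
  · rw [hP, Ideal.span_le]
    rintro _ (rfl | rfl | rfl) <;> simp [RingHom.mem_ker]

lemma three_le_height (P : Ideal (MvPolynomial (Fin 3) k)) [P.IsPrime]
    (hP : P = Ideal.span {X 0, X 1, X 2}) : 3 ≤ P.height := by
  let φ (v : Fin 3 → MvPolynomial (Fin 3) k) := aeval (R := k) v
  have hp : ∀ v, (RingHom.ker (φ v)).IsPrime := fun v => RingHom.ker_isPrime _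
  have hle : ∀ v w, (φ w).comp (φ v) = φ w → RingHom.ker (φ v) ≤ RingHom.ker (φ w) := by
    intro v w h f hf
    rw [RingHom.mem_ker] at hf ⊢
    rw [← h, AlgHom.comp_apply, hf, map_zero]
  have h01 : (⊥ : Ideal (MvPolynomial (Fin 3) k)) < RingHom.ker (φ ![0, X 1, X 2]) := by
    rw [bot_lt_iff_ne_bot]
    intro h
    have : (X 0 : MvPolynomial (Fin 3) k) ∈ RingHom.ker (φ ![0, X 1, X 2]) := by
      simp [φ, RingHom.mem_ker]
    rw [h, Ideal.mem_bot] at this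
    exact X_ne_zero _ this
  have h12 : RingHom.ker (φ ![0, X 1, X 2]) < RingHom.ker (φ ![0, 0, X 2]) := by
    refine lt_of_le_not_ge (hle _ _ ?_) fun h => ?_
    · ext i; fin_cases i <;> simp [φ]
    · have := @h (X 1) (by simp [φ, RingHom.mem_ker])
      simp [φ, RingHom.mem_ker] at this
  have h23 : RingHom.ker (φ ![0, 0, X 2]) < P := by
    rw [hP, ← ker_eq]
    refine lt_of_le_not_ge (hle _ _ ?_) fun h => ?_
    · ext i; fin_cases i <;> simp [φ]
    · have := @h (X 2) (by simp [RingHom.mem_ker])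
      simp [φ, RingHom.mem_ker] at this
  have := hp ![0, X 1, X 2]
  have := hp ![0, 0, X 2]
  have hb : (⊥ : Ideal (MvPolynomial (Fin 3) k)).IsPrime := Ideal.isPrime_bot
  have e1 := Ideal.height_add_one_le_of_lt_of_isPrime h01
  have e2 := Ideal.height_add_one_le_of_lt_of_isPrime h12
  have e3 := Ideal.height_add_one_le_of_lt_of_isPrime h23
  calc (3 : ℕ∞) = 0 + 1 + 1 + 1 := by norm_num
    _ ≤ (⊥ : Ideal (MvPolynomial (Fin 3) k)).height + 1 + 1 + 1 := by gcongr; exact zero_le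
    _ ≤ (RingHom.ker (φ ![0, X 1, X 2])).height + 1 + 1 := by gcongr
    _ ≤ (RingHom.ker (φ ![0, 0, X 2])).height + 1 := by gcongr
    _ ≤ _ := e3
end

lemma local_aux {S : Type*} [CommRing S] [IsLocalRing S] [IsNoetherianRing S] (x y z : S)
    (hm : maximalIdeal S = Ideal.span {x, y, z}) (hdim : 3 ≤ ringKrullDim S) (I : Ideal S)
    (hI : I = Ideal.span {x ^ 2 - y ^ 5, x * y ^ 2 + y * z ^ 3 - z ^ 5}) :
    ∃ hnt : Nontrivial (S ⧸ I),
        letI := hnt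
        letI : IsLocalRing (S ⧸ I) :=
          IsLocalRing.of_surjective' (Ideal.Quotient.mk I) Ideal.Quotient.mk_surjective
        IsLocalRing.maximalIdeal (S ⧸ I) ^ 6 ≤
            Ideal.span {Ideal.Quotient.mk I y} ∧
          gll (S ⧸ I) ≤ 6 := by
  have hx : x ∈ maximalIdeal S := hm ▸ Ideal.subset_span (by simp)
  have hy : y ∈ maximalIdeal S := hm ▸ Ideal.subset_span (by simp)
  have hz : z ∈ maximalIdeal S := hm ▸ Ideal.subset_span (by simp)
  have hsub : ({x ^ 2 - y ^ 5, x * y ^ 2 + y * z ^ 3 - z ^ 5} : Set S) ⊆ maximalIdeal S := by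
    rintro _ (rfl | rfl)
    · exact sub_mem (Ideal.pow_mem_of_mem _ hx _ (by norm_num))
        (Ideal.pow_mem_of_mem _ hy _ (by norm_num))
    · exact sub_mem (add_mem (Ideal.mul_mem_right _ _ hx) (Ideal.mul_mem_right _ _ hy))
        (Ideal.pow_mem_of_mem _ hz _ (by norm_num))
  have hIm : I ≤ maximalIdeal S := by rw [hI, Ideal.span_le]; exact hsub
  have hnt : Nontrivial (S ⧸ I) := Ideal.Quotient.nontrivial_iff.2
    (ne_top_of_le_ne_top (maximalIdeal.isMaximal S).ne_top hIm)
  refine ⟨hnt, ?_⟩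
  letI : IsLocalRing (S ⧸ I) :=
    IsLocalRing.of_surjective' (Ideal.Quotient.mk I) Ideal.Quotient.mk_surjective
  have hmR : maximalIdeal (S ⧸ I) =
      Ideal.span {Ideal.Quotient.mk I x, Ideal.Quotient.mk I y, Ideal.Quotient.mk I z} := by
    rw [← map_maximalIdeal_of_surjective (Ideal.Quotient.mk I) Ideal.Quotient.mk_surjective, hm,
      Ideal.map_span]
    simp [Set.image_insert_eq]
  have e1 : Ideal.Quotient.mk I (x ^ 2 - y ^ 5) = 0 :=
    Ideal.Quotient.eq_zero_iff_mem.2 (hI ▸ Ideal.subset_span (by simp))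
  have e2 : Ideal.Quotient.mk I (x * y ^ 2 + y * z ^ 3 - z ^ 5) = 0 :=
    Ideal.Quotient.eq_zero_iff_mem.2 (hI ▸ Ideal.subset_span (by simp))
  simp only [map_sub, map_add, map_mul, map_pow] at e1 e2
  have h6 : maximalIdeal (S ⧸ I) ^ 6 ≤ Ideal.span {Ideal.Quotient.mk I y} := by
    rw [hmR]
    apply pow_six_aux
    · rw [sub_eq_zero.1 e1, Ideal.mem_span_singleton]
      exact dvd_pow_self _ (by norm_num)
    · rw [← sub_eq_zero.1 e2, Ideal.mem_span_singleton]
      exact dvd_add (dvd_mul_of_dvd_right (dvd_pow_self _ (by norm_num)) _) (dvd_mul_right _ _)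
  have hyR : Ideal.Quotient.mk I y ∈ maximalIdeal (S ⧸ I) :=
    hmR ▸ Ideal.subset_span (by simp)
  have hle : ringKrullDim (S ⧸ I) ≤ 1 := by
    rw [← maximalIdeal_height_eq_ringKrullDim]
    have hpr : (Ideal.span {Ideal.Quotient.mk I y}).IsPrincipal := ⟨⟨_, rfl⟩⟩
    have := Ideal.height_le_one_of_isPrincipal_of_mem_minimalPrimes_of_isLocalRing
      (Ideal.span {Ideal.Quotient.mk I y}) ⟨⟨inferInstance, ?_⟩, ?_⟩
    · exact_mod_cast this
    · exact (Ideal.span_singleton_le_iff_mem _).2 hyR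
    · rintro q ⟨hq, hq2⟩ -
      exact hq.le_of_pow_le (h6.trans hq2)
  have hge : 1 ≤ ringKrullDim (S ⧸ I) := by
    have h := ringKrullDim_le_ringKrullDim_quotient_add_encard
      {x ^ 2 - y ^ 5, x * y ^ 2 + y * z ^ 3 - z ^ 5}
      (by rwa [IsLocalRing.ringJacobson_eq_maximalIdeal])
    rw [← hI] at h
    have hc : (({x ^ 2 - y ^ 5, x * y ^ 2 + y * z ^ 3 - z ^ 5} : Set S).encard : ℕ∞) ≤ 2 := by
      refine (Set.encard_insert_le _ _).trans ?_
      rw [Set.encard_singleton, one_add_one_eq_two]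
    have hsum := hdim.trans h
    rw [← maximalIdeal_height_eq_ringKrullDim] at hsum ⊢
    have hthree : (3 : ℕ∞) ≤ (maximalIdeal (S ⧸ I)).height + 2 := by
      refine le_trans ?_ (add_le_add_right hc _)
      rw [← WithBot.coe_add] at hsum
      exact WithBot.coe_le_coe.1 hsum
    have : (1 : ℕ∞) ≤ (maximalIdeal (S ⧸ I)).height := by
      generalize (maximalIdeal (S ⧸ I)).height = n at hthree
      induction n using ENat.recTopCoe with
      | top => exact le_top
      | coe n =>
        norm_cast at hthree ⊢
        omega
    exact_mod_cast this
  refine ⟨h6, sInf_le ⟨6, ⟨[Ideal.Quotient.mk I y], by simpa using hyR, ?_, ?_⟩, rfl⟩⟩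
  · simpa using le_antisymm hge hle
  · simpa [Ideal.ofList_singleton] using h6

/-- For the ring `R = (k[x,y,z]/(x² − y⁵, xy² + yz³ − z⁵))` localized at
`(x,y,z)`, one has `m⁶ ⊆ yR`; consequently `gℓℓ(R) ≤ 6`
(here `x = X 0`, `y = X 1`, `z = X 2`). -/
theorem pow_six_le_span_y (k : Type*) [Field k] :
    ∃ hP : (Ideal.span {X 0, X 1, X 2} : Ideal (MvPolynomial (Fin 3) k)).IsPrime,
      letI := hP
      let T := MvPolynomial (Fin 3) k
      let S := Localization.AtPrime (Ideal.span {X 0, X 1, X 2} : Ideal T)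
      let I : Ideal S := (Ideal.span {(X 0) ^ 2 - (X 1) ^ 5,
        (X 0) * (X 1) ^ 2 + (X 1) * (X 2) ^ 3 - (X 2) ^ 5}).map (algebraMap T S)
      let R := S ⧸ I
      ∃ hnt : Nontrivial R,
        letI := hnt
        letI : IsLocalRing R :=
          IsLocalRing.of_surjective' (Ideal.Quotient.mk I) Ideal.Quotient.mk_surjective
        IsLocalRing.maximalIdeal R ^ 6 ≤
            Ideal.span {Ideal.Quotient.mk I (algebraMap T S (X 1))} ∧
          gll R ≤ 6 := by
  have hP : (Ideal.span {X 0, X 1, X 2} : Ideal (MvPolynomial (Fin 3) k)).IsPrime := by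
    rw [← ker_eq]; exact RingHom.ker_isPrime _
  refine ⟨hP, ?_⟩
  letI := hP
  have hN : IsNoetherianRing (Localization.AtPrime
    (Ideal.span {X 0, X 1, X 2} : Ideal (MvPolynomial (Fin 3) k))) :=
    IsLocalization.isNoetherianRing
      (Ideal.span {X 0, X 1, X 2} : Ideal (MvPolynomial (Fin 3) k)).primeCompl _ inferInstance
  let f := algebraMap (MvPolynomial (Fin 3) k) (Localization.AtPrime
    (Ideal.span {X 0, X 1, X 2} : Ideal (MvPolynomial (Fin 3) k)))
  refine local_aux (f (X 0)) (f (X 1)) (f (X 2)) ?_ ?_ _ ?_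
  · rw [← IsLocalization.AtPrime.map_eq_maximalIdeal
      (Ideal.span {X 0, X 1, X 2} : Ideal (MvPolynomial (Fin 3) k)), Ideal.map_span]
    simp only [Set.image_insert_eq, Set.image_singleton, f]
  · rw [IsLocalization.AtPrime.ringKrullDim_eq_height
      (Ideal.span {X 0, X 1, X 2} : Ideal (MvPolynomial (Fin 3) k))]
    exact WithBot.coe_le_coe.2 (three_le_height k _ rfl)
  · rw [Ideal.map_span]
    simp only [Set.image_insert_eq, Set.image_singleton, map_sub, map_add, map_mul, map_pow, f]
end
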